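/- arXiv:1202.0952 — 3 statements merged into one kernel-verified Lean document; each statement's English description precedes it below -/
import Mathlib

section
/- Let f ∈ Dom_+(Γ) with f → ∞. Suppose there exist constants a > 0, c > 0 and p > 0 such that f^p ∈ Dom_+(Γ) and Γf^p(x) ≤ −c·f(x)^{p−2} for all x with f(x) > a. Then E_x(τ_{{f ≤ a}}^q) < ∞ for every 0 < q < p/2 and every x ∈ 𝕏. -/
open MeasureTheory Set Filter
open scoped Classical ENNReal NNReal

/-- A continuous-time Markov chain on a countably infinite state space `X`,
described by its generator `Γ`, together with a probability space carrying,
for each starting point `x`, the embedded jump chain `jump` and the holding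
times `hold` (with `hold n` the holding time at the `n`-th visited state). -/
structure CTMC where
  X : Type
  countX : Countable X
  infX : Infinite X
  Γ : X → X → ℝ
  γ : X → ℝ
  γ_pos : ∀ x, 0 < γ x
  Γ_offdiag_nonneg : ∀ x y, y ≠ x → 0 ≤ Γ x y
  Γ_diag : ∀ x, Γ x x = - γ x
  γ_sum : ∀ x, HasSum (fun y => if y = x then 0 else Γ x y) (γ x)
  /-- irreducibility of the embedded jump chain -/
  irr : ∀ x y : X, ∃ (n : ℕ) (path : ℕ → X), path 0 = x ∧ path n = y ∧
    ∀ k, k < n → 0 < (if path (k+1) = path k then 0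
      else Γ (path k) (path (k+1)) / γ (path k))
  Ω : Type
  measΩ : MeasurableSpace Ω
  μ : X → @Measure Ω measΩ
  probμ : ∀ x, @IsProbabilityMeasure Ω measΩ (μ x)
  jump : ℕ → Ω → X
  hold : ℕ → Ω → ℝ
  jump_meas : ∀ (n : ℕ) (x : X), MeasurableSet[measΩ] {ω | jump n ω = x}
  hold_meas : ∀ n : ℕ, @Measurable Ω ℝ measΩ _ (hold n)
  hold_pos : ∀ n ω, 0 < hold n ω
  /-- under `μ x` the chain starts at `x` -/
  start : ∀ x : X, μ x {ω | jump 0 ω = x} = 1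
  /-- finite-dimensional law: the embedded chain is Markov with transition
  probabilities `P x y = Γ x y / γ x` (for `y ≠ x`), and conditionally on the
  embedded chain the holding times are independent exponentials of rates
  `γ (jump n)` -/
  law : ∀ (x : X) (n : ℕ) (path : ℕ → X) (t : ℕ → ℝ), path 0 = x → (∀ k, 0 ≤ t k) →
    μ x {ω | (∀ k, k ≤ n → jump k ω = path k) ∧ (∀ k, k < n → t k < hold k ω)}
      = ENNReal.ofReal (∏ k ∈ Finset.range n,
          ((if path (k+1) = path k then 0 else Γ (path k) (path (k+1)) / γ (path k))
            * Real.exp (-(γ (path k)) * t k)))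

namespace CTMC

attribute [instance] CTMC.countX CTMC.infX CTMC.measΩ CTMC.probμ

variable (M : CTMC)

/-- embedded chain transition probabilities -/
noncomputable def P (x y : M.X) : ℝ := if y = x then 0 else M.Γ x y / M.γ x

/-- jump times -/
noncomputable def J (n : ℕ) (ω : M.Ω) : ℝ := ∑ k ∈ Finset.range n, M.hold k ω

/-- explosion (life) time -/
noncomputable def zeta (ω : M.Ω) : ℝ≥0∞ := ⨆ n, ENNReal.ofReal (M.J n ω)

/-- the continuous-time chain: `pos t ω = some (jump n ω)` if `J n ≤ t < J (n+1)`,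
and `none` (the cemetery state `∂`) after the explosion time. -/
noncomputable def pos (t : ℝ) (ω : M.Ω) : Option M.X :=
  if h : ∃ n, M.J n ω ≤ t ∧ t < M.J (n+1) ω then some (M.jump h.choose ω) else none

/-- passage time: `τ_A = inf {t ≥ 0 : ξ_t ∈ A}` -/
noncomputable def tau (A : Set M.X) (ω : M.Ω) : ℝ≥0∞ :=
  sInf (ENNReal.ofReal '' {s : ℝ | 0 ≤ s ∧ ∃ a ∈ A, M.pos s ω = some a})

/-- `f` belongs to the domain of the generator -/
def InDom (f : M.X → ℝ) : Prop :=
  ∀ x : M.X, Summable (fun y => if y = x then 0 else M.Γ x y * f y)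

/-- `f ∈ Dom_+(Γ)` -/
def InDomPos (f : M.X → ℝ) : Prop := (∀ x, 0 ≤ f x) ∧ M.InDom f

/-- action of the generator : `Γ f (x) = ∑_y Γ_{xy} f(y)` -/
noncomputable def gen (f : M.X → ℝ) (x : M.X) : ℝ :=
  (∑' y, if y = x then 0 else M.Γ x y * f y) - M.γ x * f x

/-- recurrence of the embedded jump chain -/
def JumpRecurrent : Prop := ∀ x : M.X, M.μ x {ω | ∃ n, 1 ≤ n ∧ M.jump n ω = x} = 1

/-- `f → ∞` : all sublevel sets are finite -/
def FinSublevels (f : M.X → ℝ) : Prop := ∀ r : ℝ, {x : M.X | f x ≤ r}.Finite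

end CTMC

namespace CTMCAux

/-- exponential law of rate `g` -/
noncomputable def expM (g : ℝ) : Measure ℝ :=
  (volume.restrict (Ioi 0)).withDensity (fun s => ENNReal.ofReal (g * Real.exp (-g * s)))

lemma lintegral_expM (g : ℝ) {F : ℝ → ℝ≥0∞} (hF : Measurable F) :
    ∫⁻ s, F s ∂expM g = ∫⁻ s in Ioi 0, ENNReal.ofReal (g * Real.exp (-g * s)) * F s := by
  unfold expM
  rw [lintegral_withDensity_eq_lintegral_mul _ (by fun_prop) hF]
  rfl

lemma expM_Ioi {g : ℝ} (hg : 0 < g) {t : ℝ} (ht : 0 ≤ t) :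
    expM g (Ioi t) = ENNReal.ofReal (Real.exp (-g * t)) := by
  unfold expM
  rw [withDensity_apply _ measurableSet_Ioi, Measure.restrict_restrict measurableSet_Ioi,
    Ioi_inter_Ioi, max_eq_left ht, ← ofReal_integral_eq_lintegral_ofReal]
  · rw [integral_const_mul, integral_exp_mul_Ioi (by linarith)]
    congr 1
    field_simp
  · exact (integrableOn_exp_mul_Ioi (by linarith) t).const_mul g
  · exact Eventually.of_forall fun s => by positivity

lemma expM_Ioi_max {g : ℝ} (hg : 0 < g) (t : ℝ) :
    expM g (Ioi t) = ENNReal.ofReal (Real.exp (-g * max t 0)) := by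
  rcases le_total 0 t with ht | ht
  · rw [max_eq_left ht, expM_Ioi hg ht]
  · rw [max_eq_right ht, ← expM_Ioi hg le_rfl]
    have h1 : expM g = (expM g).restrict (Ioi 0) := by
      unfold expM
      rw [restrict_withDensity measurableSet_Ioi, Measure.restrict_restrict measurableSet_Ioi,
        inter_self]
    conv_lhs => rw [h1]
    rw [Measure.restrict_apply measurableSet_Ioi, Ioi_inter_Ioi, max_eq_right ht]

lemma expM_univ {g : ℝ} (hg : 0 < g) : expM g univ = 1 := by
  have h1 : expM g = (expM g).restrict (Ioi 0) := by
    unfold expM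
    rw [restrict_withDensity measurableSet_Ioi, Measure.restrict_restrict measurableSet_Ioi,
      inter_self]
  rw [h1, Measure.restrict_apply MeasurableSet.univ, univ_inter, expM_Ioi hg le_rfl]
  simp

variable (M : CTMC)

lemma P_nonneg (x y : M.X) : 0 ≤ M.P x y := by
  unfold CTMC.P
  split_ifs with h
  · exact le_rfl
  · exact div_nonneg (M.Γ_offdiag_nonneg x y h) (M.γ_pos x).le

/-- path cylinder -/
def E (n : ℕ) (path : ℕ → M.X) : Set M.Ω := {ω | ∀ k, k ≤ n → M.jump k ω = path k}

lemma measE (n : ℕ) (path : ℕ → M.X) : MeasurableSet (E M n path) := by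
  have : E M n path = ⋂ k, ⋂ (_ : k ≤ n), {ω | M.jump k ω = path k} := by
    ext; simp [E]
  rw [this]
  exact MeasurableSet.iInter fun k => MeasurableSet.iInter fun _ => M.jump_meas k _

lemma meas_hold (n : ℕ) : Measurable (fun ω (k : Fin n) => M.hold k ω) :=
  measurable_pi_lambda _ fun k => M.hold_meas k

lemma meas_J (n : ℕ) : Measurable (M.J n) := by
  unfold CTMC.J
  exact Finset.measurable_sum _ fun k _ => M.hold_meas k

/-- weighted exponential -/
noncomputable def wexp (path : ℕ → M.X) (k : ℕ) : Measure ℝ :=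
  ENNReal.ofReal (M.P (path k) (path (k+1))) • expM (M.γ (path k))

instance (path : ℕ → M.X) (k : ℕ) : IsFiniteMeasure (wexp M path k) := by
  constructor
  unfold wexp
  rw [Measure.smul_apply, expM_univ (M.γ_pos _)]
  simp

lemma law_pi (x : M.X) (n : ℕ) (path : ℕ → M.X) (h0 : path 0 = x) :
    Measure.pi (fun k : Fin n => wexp M path k) =
    ((M.μ x).restrict (E M n path)).map (fun ω (k : Fin n) => M.hold k ω) := by
  apply Measure.pi_eq_generateFrom (C := fun _ => range Ioi)
  · intro i
    exact ((BorelSpace.measurable_eq (α := ℝ)).trans (borel_eq_generateFrom_Ioi ℝ)).symm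
  · intro i; exact isPiSystem_Ioi
  · intro i
    exact ⟨fun j => Ioi (-(j:ℝ)), fun j => ⟨_, rfl⟩, fun j => measure_lt_top _ _, by
      rw [eq_univ_iff_forall]
      intro y
      obtain ⟨j, hj⟩ := exists_nat_gt (-y)
      exact mem_iUnion.2 ⟨j, by simp only [mem_Ioi]; linarith⟩⟩
  · intro s hs
    choose t ht using hs
    obtain rfl : (fun i => Ioi (t i)) = s := funext ht
    rw [Measure.map_apply (meas_hold M n) (MeasurableSet.univ_pi fun i => measurableSet_Ioi),
      Measure.restrict_apply ((meas_hold M n) (MeasurableSet.univ_pi fun i => measurableSet_Ioi))]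
    have hl := M.law x n path (fun k => if h : k < n then max (t ⟨k, h⟩) 0 else 0) h0
      (by intro k; split_ifs <;> simp)
    have hset : (fun ω (k : Fin n) => M.hold k ω) ⁻¹' (univ.pi fun i => Ioi (t i)) ∩ E M n path
      = {ω | (∀ k, k ≤ n → M.jump k ω = path k) ∧ (∀ k, k < n →
        (if h : k < n then max (t ⟨k, h⟩) 0 else 0) < M.hold k ω)} := by
      ext ω
      simp only [mem_inter_iff, mem_preimage, mem_univ_pi, mem_Ioi, E, mem_ofPred_eq]
      rw [and_comm]
      refine and_congr_right fun _ => ⟨fun h k hk => ?_, fun h k => ?_⟩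
      · rw [dif_pos hk]; exact max_lt (h ⟨k, hk⟩) (M.hold_pos _ _)
      · have := h k k.2
        rw [dif_pos k.2] at this
        exact lt_of_le_of_lt (le_max_left _ _) this
    rw [hset, hl, Finset.prod_range, ENNReal.ofReal_prod_of_nonneg]
    · refine Finset.prod_congr rfl fun i _ => ?_
      have := P_nonneg M (path i) (path (i+1))
      unfold wexp
      rw [Measure.smul_apply, expM_Ioi_max (M.γ_pos _), smul_eq_mul, ← ENNReal.ofReal_mul this]
      simp [CTMC.P]
    · intro i _
      have := P_nonneg M (path i) (path (i+1))
      exact mul_nonneg this (Real.exp_pos _).le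

lemma markov (x : M.X) (n : ℕ) (path : ℕ → M.X) (h0 : path 0 = x) {F : ℝ → ℝ≥0∞}
    (hF : Measurable F) :
    ∫⁻ ω in E M (n+1) path, F (M.J (n+1) ω) ∂M.μ x =
      ∫⁻ ω in E M n path, ENNReal.ofReal (M.P (path n) (path (n+1))) *
        ∫⁻ s, F (M.J n ω + s) ∂expM (M.γ (path n)) ∂M.μ x := by
  have hsf : ∀ k : ℕ, SFinite (wexp M path k) := fun k => inferInstance
  have e1 : ∫⁻ ω in E M (n+1) path, F (M.J (n+1) ω) ∂M.μ x
      = ∫⁻ h, F (∑ k, h k) ∂Measure.pi (fun k : Fin (n+1) => wexp M path k) := by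
    rw [law_pi M x (n+1) path h0, lintegral_map (by fun_prop) (meas_hold M _)]
    simp only [CTMC.J, Finset.sum_range]
  have hm : Measurable (fun z : ℝ × (Fin n → ℝ) => F (∑ k, z.2 k + z.1)) := by fun_prop
  have e2 : ∫⁻ h, F (∑ k, h k) ∂Measure.pi (fun k : Fin (n+1) => wexp M path k)
      = ∫⁻ h, ∫⁻ s, F (∑ k, h k + s) ∂(wexp M path n)
          ∂Measure.pi (fun k : Fin n => wexp M path k) := by
    have mp := measurePreserving_piFinSuccAbove (fun k : Fin (n+1) => wexp M path k) (Fin.last n)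
    have h2 := mp.lintegral_comp hm
    simp only [Fin.succAbove_last, Fin.val_castSucc, Fin.val_last] at h2
    rw [lintegral_prod_symm' _ hm] at h2
    rw [← h2]
    refine lintegral_congr fun h => ?_
    rw [Fin.sum_univ_castSucc]
    congr 2
    simp [MeasurableEquiv.piFinSuccAbove, Fin.insertNthEquiv, Fin.init]
  rw [e1, e2, law_pi M x n path h0, lintegral_map _ (meas_hold M _)]
  · refine lintegral_congr fun ω => ?_
    unfold wexp
    rw [lintegral_smul_measure]
    simp only [CTMC.J, Finset.sum_range, smul_eq_mul]
  · have hm' : Measurable (fun z : (Fin n → ℝ) × ℝ => F (∑ k, z.1 k + z.2)) := by fun_prop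
    exact hm'.lintegral_prod_right'

/-- one step operator of the space-time jump chain -/
noncomputable def Q (V : M.X → ℝ → ℝ≥0∞) (x : M.X) (t : ℝ) : ℝ≥0∞ :=
  ∫⁻ s, ∑' y, ENNReal.ofReal (M.P x y) * V y (t + s) ∂expM (M.γ x)

/-- not yet hit at step `n` -/
def B (A : Set M.X) (n : ℕ) : Set M.Ω := {ω | ∀ k, k ≤ n → M.jump k ω ∉ A}

/-- first hit at step `n` -/
def C (A : Set M.X) (n : ℕ) : Set M.Ω := {ω | (∀ k, k < n → M.jump k ω ∉ A) ∧ M.jump n ω ∈ A}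

lemma meas_jump_comp (n : ℕ) {V : M.X → ℝ → ℝ≥0∞} (hV : ∀ y, Measurable (V y)) :
    Measurable (fun ω => V (M.jump n ω) (M.J n ω)) := by
  let _ : MeasurableSpace M.X := ⊤
  have hj : Measurable (M.jump n) := measurable_to_countable' fun y => M.jump_meas n y
  have h2 : Measurable (fun z : M.X × ℝ => V z.1 z.2) := measurable_from_prod_countable_right hV
  exact h2.comp (hj.prodMk (meas_J M n))

lemma meas_jump_set (n : ℕ) (A : Set M.X) : MeasurableSet {ω | M.jump n ω ∈ A} := by
  let _ : MeasurableSpace M.X := ⊤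
  have hj : Measurable (M.jump n) := measurable_to_countable' fun y => M.jump_meas n y
  exact hj (MeasurableSpace.measurableSet_top (s := A))

lemma measB (A : Set M.X) (n : ℕ) : MeasurableSet (B M A n) := by
  have : B M A n = ⋂ k, ⋂ (_ : k ≤ n), {ω | M.jump k ω ∈ Aᶜ} := by
    ext; simp [B]
  rw [this]
  exact MeasurableSet.iInter fun k => MeasurableSet.iInter fun _ => meas_jump_set M k _

lemma measC (A : Set M.X) (n : ℕ) : MeasurableSet (C M A n) := by
  have : C M A n = (⋂ k, ⋂ (_ : k < n), {ω | M.jump k ω ∈ Aᶜ}) ∩ {ω | M.jump n ω ∈ A} := by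
    ext; simp [C]
  rw [this]
  exact (MeasurableSet.iInter fun k => MeasurableSet.iInter fun _ => meas_jump_set M k _).inter
    (meas_jump_set M n A)

lemma meas_Q {V : M.X → ℝ → ℝ≥0∞} (hV : ∀ y, Measurable (V y)) (x : M.X) :
    Measurable (Q M V x) := by
  unfold Q
  have : IsFiniteMeasure (expM (M.γ x)) := ⟨by rw [expM_univ (M.γ_pos x)]; simp⟩
  have : Measurable (fun z : ℝ × ℝ => ∑' y, ENNReal.ofReal (M.P x y) * V y (z.1 + z.2)) := by
    refine Measurable.tsum fun y => ?_
    have := hV y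
    fun_prop
  exact this.lintegral_prod_right'

lemma start_ae (x : M.X) : ∀ᵐ ω ∂M.μ x, M.jump 0 ω = x := by
  have := M.start x
  rwa [prob_compl_eq_zero_iff (M.jump_meas 0 x) |>.symm] at this

lemma step_path (x : M.X) (n : ℕ) (path : ℕ → M.X) (h0 : path 0 = x)
    {V : M.X → ℝ → ℝ≥0∞} (hV : ∀ y, Measurable (V y)) :
    ∫⁻ ω in E M n path, V (M.jump (n+1) ω) (M.J (n+1) ω) ∂M.μ x =
      ∫⁻ ω in E M n path, Q M V (M.jump n ω) (M.J n ω) ∂M.μ x := by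
  have : IsFiniteMeasure (expM (M.γ (path n))) := ⟨by rw [expM_univ (M.γ_pos _)]; simp⟩
  let pe : M.X → ℕ → M.X := fun y => Function.update path (n+1) y
  have hpe : ∀ y k, k ≤ n → pe y k = path k := fun y k hk => by
    simp only [pe]; rw [Function.update_of_ne (by omega)]
  have hpe' : ∀ y, pe y (n+1) = y := fun y => by simp [pe]
  have hEn : ∀ y, E M n (pe y) = E M n path := fun y => by
    ext ω
    exact forall_congr' fun k => forall_congr' fun hk => by rw [hpe y k hk]
  have hU : E M n path = ⋃ y, E M (n+1) (pe y) := by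
    ext ω
    simp only [mem_iUnion]
    constructor
    · intro h
      refine ⟨M.jump (n+1) ω, fun k hk => ?_⟩
      rcases Nat.le_succ_iff.1 hk with hk | rfl
      · rw [hpe _ _ hk]; exact h k hk
      · exact (hpe' _).symm
    · rintro ⟨y, h⟩ k hk
      rw [h k (by omega), hpe _ _ hk]
  have hd : Pairwise (Function.onFun Disjoint fun y => E M (n+1) (pe y)) := by
    intro y z hyz
    refine Set.disjoint_left.2 fun ω h1 h2 => hyz ?_
    rw [← hpe' y, ← hpe' z, ← h1 (n+1) le_rfl, ← h2 (n+1) le_rfl]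
  conv_lhs => rw [hU]
  rw [lintegral_iUnion (fun y => measE M _ _) hd]
  have hterm : ∀ y, ∫⁻ ω in E M (n+1) (pe y), V (M.jump (n+1) ω) (M.J (n+1) ω) ∂M.μ x
      = ∫⁻ ω in E M n path, ENNReal.ofReal (M.P (path n) y) *
        ∫⁻ s, V y (M.J n ω + s) ∂expM (M.γ (path n)) ∂M.μ x := by
    intro y
    have h := markov M x n (pe y) (by rw [hpe y 0 (by omega), h0]) (hV y)
    rw [hpe' y, hpe y n le_rfl, hEn] at h
    rw [← h]
    refine setLIntegral_congr_fun (measE M _ _) fun ω hω => ?_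
    rw [hω (n+1) le_rfl, hpe' y]
  simp_rw [hterm]
  rw [← lintegral_tsum]
  · refine setLIntegral_congr_fun (measE M _ _) fun ω hω => ?_
    rw [hω n le_rfl]
    unfold Q
    rw [lintegral_tsum]
    · refine tsum_congr fun y => ?_
      have := hV y
      rw [lintegral_const_mul _ (by fun_prop)]
    · intro y
      have := hV y
      fun_prop
  · intro y
    have h1 : Measurable (fun z : ℝ × ℝ => V y (z.1 + z.2)) := by
      have := hV y
      fun_prop
    have h2 : Measurable (fun t => ∫⁻ s, V y (t + s) ∂expM (M.γ (path n))) :=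
      h1.lintegral_prod_right'
    exact ((h2.comp (meas_J M n)).const_mul _).aemeasurable

lemma step (A : Set M.X) (x : M.X) (n : ℕ)
    {V : M.X → ℝ → ℝ≥0∞} (hV : ∀ y, Measurable (V y)) :
    ∫⁻ ω in B M A n, V (M.jump (n+1) ω) (M.J (n+1) ω) ∂M.μ x =
      ∫⁻ ω in B M A n, Q M V (M.jump n ω) (M.J n ω) ∂M.μ x := by
  let pe : (Fin (n+1) → M.X) → ℕ → M.X := fun i k => if h : k < n + 1 then i ⟨k, h⟩ else x
  have hpe : ∀ i k (h : k < n + 1), pe i k = i ⟨k, h⟩ := fun i k h => dif_pos h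
  have hU : B M A n = ⋃ i, B M A n ∩ E M n (pe i) := by
    rw [← inter_iUnion]
    refine (inter_eq_left.2 fun ω _ => mem_iUnion.2 ⟨fun k : Fin (n+1) => M.jump k ω, ?_⟩).symm
    intro k hk
    exact (hpe (fun k : Fin (n+1) => M.jump k ω) k (by omega)).symm
  have hd : Pairwise (Function.onFun Disjoint fun i => B M A n ∩ E M n (pe i)) := by
    intro i j hij
    refine Set.disjoint_left.2 fun ω h1 h2 => hij ?_
    funext k
    rw [← hpe i k k.2, ← hpe j k k.2, ← h1.2 k (by omega), ← h2.2 k (by omega)]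
  rw [hU, lintegral_iUnion (fun i => (measB M A n).inter (measE M _ _)) hd,
    lintegral_iUnion (fun i => (measB M A n).inter (measE M _ _)) hd]
  refine tsum_congr fun i => ?_
  by_cases hne : (B M A n ∩ E M n (pe i)).Nonempty
  · obtain ⟨ω₀, h1, h2⟩ := hne
    have hE : B M A n ∩ E M n (pe i) = E M n (pe i) := by
      refine inter_eq_right.2 fun ω hω k hk => ?_
      rw [hω k hk, ← h2 k hk]
      exact h1 k hk
    rw [hE]
    by_cases h0 : pe i 0 = x
    · exact step_path M x n _ h0 hV
    · have hz : M.μ x (E M n (pe i)) = 0 := by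
        refine measure_mono_null (fun ω hω => ?_) (start_ae M x)
        simp only [mem_compl_iff, mem_ofPred_eq]
        rw [hω 0 (by omega)]
        exact h0
      rw [Measure.restrict_eq_zero.2 hz]
      simp
  · rw [not_nonempty_iff_eq_empty.1 hne]; simp

lemma J_nonneg (n : ℕ) (ω : M.Ω) : 0 ≤ M.J n ω :=
  Finset.sum_nonneg fun k _ => (M.hold_pos k ω).le

lemma telescope (A : Set M.X) (x : M.X)
    {V : M.X → ℝ → ℝ≥0∞} (hV : ∀ y, Measurable (V y)) (D : M.X → ℝ≥0∞)
    (hS : ∀ y, y ∉ A → ∀ t, 0 ≤ t → Q M V y t + D y ≤ V y t) (n : ℕ) :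
    ∑ k ∈ Finset.range (n+1), ∫⁻ ω in C M A k, V (M.jump k ω) (M.J k ω) ∂M.μ x
      + ∑ k ∈ Finset.range n, ∫⁻ ω in B M A k, D (M.jump k ω) ∂M.μ x
      + ∫⁻ ω in B M A n, V (M.jump n ω) (M.J n ω) ∂M.μ x ≤ V x 0 := by
  induction n with
  | zero =>
    simp only [zero_add, Finset.range_one, Finset.sum_singleton, Finset.range_zero,
      Finset.sum_empty, add_zero]
    have hc : B M A 0 = (C M A 0)ᶜ := by ext; simp [B, C]
    rw [hc, lintegral_add_compl _ (measC M A 0)]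
    have : ∫⁻ ω, V (M.jump 0 ω) (M.J 0 ω) ∂M.μ x = ∫⁻ ω, V x 0 ∂M.μ x := by
      refine lintegral_congr_ae ?_
      filter_upwards [start_ae M x] with ω hω
      simp [hω, CTMC.J]
    rw [this]
    simp
  | succ n ih =>
    refine le_trans ?_ ih
    rw [Finset.sum_range_succ (fun k => ∫⁻ ω in C M A k, V (M.jump k ω) (M.J k ω) ∂M.μ x) (n+1),
      Finset.sum_range_succ (fun k => ∫⁻ ω in B M A k, D (M.jump k ω) ∂M.μ x) n]
    have key : ∫⁻ ω in C M A (n+1), V (M.jump (n+1) ω) (M.J (n+1) ω) ∂M.μ x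
        + ∫⁻ ω in B M A n, D (M.jump n ω) ∂M.μ x
        + ∫⁻ ω in B M A (n+1), V (M.jump (n+1) ω) (M.J (n+1) ω) ∂M.μ x
        ≤ ∫⁻ ω in B M A n, V (M.jump n ω) (M.J n ω) ∂M.μ x := by
      have hu : B M A n = C M A (n+1) ∪ B M A (n+1) := by
        ext ω
        simp only [B, C, mem_union, mem_ofPred_eq, Nat.lt_succ_iff]
        constructor
        · intro h
          by_cases hA : M.jump (n+1) ω ∈ A
          · exact Or.inl ⟨h, hA⟩
          · refine Or.inr fun k hk => ?_
            rcases Nat.le_succ_iff.1 hk with hk | rfl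
            · exact h k hk
            · exact hA
        · rintro (h | h) k hk
          · exact h.1 k hk
          · exact h k (by omega)
      have hd : Disjoint (C M A (n+1)) (B M A (n+1)) :=
        Set.disjoint_left.2 fun ω h1 h2 => h2 (n+1) le_rfl h1.2
      have h1 : ∫⁻ ω in C M A (n+1), V (M.jump (n+1) ω) (M.J (n+1) ω) ∂M.μ x
        + ∫⁻ ω in B M A (n+1), V (M.jump (n+1) ω) (M.J (n+1) ω) ∂M.μ x
        = ∫⁻ ω in B M A n, Q M V (M.jump n ω) (M.J n ω) ∂M.μ x := by
        rw [← lintegral_union (measB M A (n+1)) hd, ← hu, step M A x n hV]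
      rw [add_right_comm, h1, ← lintegral_add_left (meas_jump_comp M n (meas_Q M hV))]
      refine setLIntegral_mono' (measB M A n) fun ω hω => ?_
      exact hS _ (hω n le_rfl) _ (J_nonneg M n ω)
    calc _ = (∑ k ∈ Finset.range (n+1), ∫⁻ ω in C M A k, V (M.jump k ω) (M.J k ω) ∂M.μ x
      + ∑ k ∈ Finset.range n, ∫⁻ ω in B M A k, D (M.jump k ω) ∂M.μ x) +
        (∫⁻ ω in C M A (n+1), V (M.jump (n+1) ω) (M.J (n+1) ω) ∂M.μ x
        + ∫⁻ ω in B M A n, D (M.jump n ω) ∂M.μ x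
        + ∫⁻ ω in B M A (n+1), V (M.jump (n+1) ω) (M.J (n+1) ω) ∂M.μ x) := by ring
      _ ≤ _ := by gcongr

lemma hit_sum (A : Set M.X) (x : M.X)
    {V : M.X → ℝ → ℝ≥0∞} (hV : ∀ y, Measurable (V y))
    (hS : ∀ y, y ∉ A → ∀ t, 0 ≤ t → Q M V y t ≤ V y t) :
    ∑' k, ∫⁻ ω in C M A k, V (M.jump k ω) (M.J k ω) ∂M.μ x ≤ V x 0 := by
  refine ENNReal.tsum_le_of_sum_range_le fun n => ?_
  have h := telescope M A x hV (fun _ => 0) (by simpa using hS) n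
  refine le_trans ?_ h
  rw [Finset.sum_range_succ, add_assoc, add_assoc]
  exact le_self_add

lemma never_zero (A : Set M.X) (x : M.X) (V : M.X → ℝ≥0∞) (D : M.X → ℝ≥0∞)
    (hfin : V x ≠ ⊤) (hD : ∀ y, y ∉ A → D y ≠ 0)
    (hS : ∀ y, y ∉ A → ∀ t, 0 ≤ t → Q M (fun y _ => V y) y t + D y ≤ V y)
    (hsub : ∀ R : ℕ, {y | V y ≤ R}.Finite) :
    M.μ x (⋂ n, B M A n) = 0 := by
  have hT := telescope M A x (V := fun y _ => V y) (fun y => measurable_const) D hS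
  have hvis : ∀ y, Tendsto (fun n => M.μ x (B M A n ∩ {ω | M.jump n ω = y})) atTop (nhds 0) := by
    intro y
    by_cases hy : y ∈ A
    · have : ∀ n, B M A n ∩ {ω | M.jump n ω = y} = ∅ := fun n => by
        ext ω
        simp only [mem_inter_iff, mem_ofPred_eq, mem_empty_iff_false, iff_false, not_and]
        rintro h rfl
        exact h n le_rfl hy
      simp [this]
    · apply ENNReal.tendsto_atTop_zero_of_tsum_ne_top
      have h1 : D y * ∑' n, M.μ x (B M A n ∩ {ω | M.jump n ω = y}) ≤ V x := by
        rw [← ENNReal.tsum_mul_left]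
        refine ENNReal.tsum_le_of_sum_range_le fun n => ?_
        refine le_trans ?_ (hT n)
        refine le_trans (Finset.sum_le_sum fun k _ => ?_) (le_trans le_add_self le_self_add)
        calc D y * M.μ x (B M A k ∩ {ω | M.jump k ω = y})
            = ∫⁻ ω in B M A k ∩ {ω | M.jump k ω = y}, D y ∂M.μ x := by simp
          _ = ∫⁻ ω in B M A k ∩ {ω | M.jump k ω = y}, D (M.jump k ω) ∂M.μ x := by
            refine setLIntegral_congr_fun ((measB M A k).inter (M.jump_meas k y)) fun ω hω => ?_
            have : M.jump k ω = y := hω.2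
            simp [this]
          _ ≤ _ := lintegral_mono_set inter_subset_left
      intro htop
      rw [htop, ENNReal.mul_top (hD y hy)] at h1
      exact hfin (top_le_iff.1 h1)
  have hR : ∀ R : ℕ, (R : ℝ≥0∞) * M.μ x (⋂ n, B M A n) ≤ V x := by
    intro R
    have hlim : Tendsto (fun n => (R : ℝ≥0∞) * ∑ y ∈ (hsub R).toFinset,
        M.μ x (B M A n ∩ {ω | M.jump n ω = y}) + V x) atTop (nhds (R * ∑ y ∈ (hsub R).toFinset,
          0 + V x)) := by
      refine Tendsto.add ?_ tendsto_const_nhds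
      refine ENNReal.Tendsto.const_mul ?_ (Or.inr (by simp))
      exact tendsto_finsetSum _ fun y _ => hvis y
    simp only [Finset.sum_const_zero, mul_zero, zero_add] at hlim
    refine ge_of_tendsto hlim (Eventually.of_forall fun n => ?_)
    have hmeas := meas_jump_comp M n (V := fun y _ => V y) (fun y => measurable_const)
    have h2 := mul_meas_ge_le_lintegral (μ := (M.μ x).restrict (B M A n)) hmeas R
    have h3 : ∫⁻ ω in B M A n, V (M.jump n ω) ∂M.μ x ≤ V x :=
      le_trans le_add_self (hT n)
    have h4 : B M A n ⊆ (⋃ y ∈ (hsub R).toFinset, B M A n ∩ {ω | M.jump n ω = y}) ∪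
        ({ω | (R:ℝ≥0∞) ≤ V (M.jump n ω)} ∩ B M A n) := by
      intro ω hω
      rcases le_total (V (M.jump n ω)) R with h | h
      · left
        simp only [mem_iUnion]
        exact ⟨M.jump n ω, by simpa using h, hω, rfl⟩
      · right; exact ⟨h, hω⟩
    calc (R : ℝ≥0∞) * M.μ x (⋂ n, B M A n) ≤ R * (∑ y ∈ (hsub R).toFinset,
          M.μ x (B M A n ∩ {ω | M.jump n ω = y}) +
            M.μ x ({ω | (R:ℝ≥0∞) ≤ V (M.jump n ω)} ∩ B M A n)) := by
          gcongr
          refine (measure_mono ((iInter_subset _ n).trans h4)).trans ?_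
          refine (measure_union_le _ _).trans ?_
          gcongr
          exact measure_biUnion_finset_le _ _
      _ ≤ _ := by
          rw [mul_add]
          gcongr
          refine le_trans ?_ (h2.trans h3)
          exact mul_le_mul' le_rfl (Measure.le_restrict_apply _ _)
  by_contra hne
  obtain ⟨R, hR'⟩ := ENNReal.exists_nat_mul_gt hne hfin
  exact absurd (hR R) (not_le.2 hR')

lemma tau_le (A : Set M.X) (k : ℕ) (ω : M.Ω) (h : ω ∈ C M A k) :
    M.tau A ω ≤ ENNReal.ofReal (M.J k ω) := by
  have hmono : StrictMono fun n => M.J n ω := strictMono_nat_of_lt_succ fun n => by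
    simp only [CTMC.J, Finset.sum_range_succ]
    linarith [M.hold_pos n ω]
  refine sInf_le ⟨M.J k ω, ⟨J_nonneg M k ω, M.jump k ω, h.2, ?_⟩, rfl⟩
  have hex : ∃ n, M.J n ω ≤ M.J k ω ∧ M.J k ω < M.J (n+1) ω := ⟨k, le_rfl, hmono (Nat.lt_succ_self k)⟩
  unfold CTMC.pos
  rw [dif_pos hex]
  obtain ⟨h1, h2⟩ := hex.choose_spec
  have h1' := hmono.le_iff_le.1 h1
  have h2' := hmono.lt_iff_lt.1 h2
  have : hex.choose = k := by omega
  rw [this]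

lemma main_bound (A : Set M.X) (x : M.X) (q : ℝ) (hq : 0 < q)
    (hnev : M.μ x (⋂ n, B M A n) = 0)
    {V : M.X → ℝ → ℝ≥0∞} (hV : ∀ y, Measurable (V y))
    (hS : ∀ y, y ∉ A → ∀ t, 0 ≤ t → Q M V y t ≤ V y t)
    (hb : ∀ y t, 0 ≤ t → ENNReal.ofReal t ^ q ≤ V y t) :
    ∫⁻ ω, M.tau A ω ^ q ∂M.μ x ≤ V x 0 := by
  refine le_trans ?_ (hit_sum M A x hV hS)
  have hcov : (⋃ k, C M A k) ∪ ⋂ n, B M A n = univ := by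
    rw [eq_univ_iff_forall]
    intro ω
    by_cases h : ∃ k, M.jump k ω ∈ A
    · left
      exact mem_iUnion.2 ⟨Nat.find h, fun k hk => Nat.find_min h hk, Nat.find_spec h⟩
    · right
      push Not at h
      exact mem_iInter.2 fun n k _ => h k
  calc ∫⁻ ω, M.tau A ω ^ q ∂M.μ x
      = ∫⁻ ω in (⋃ k, C M A k) ∪ ⋂ n, B M A n, M.tau A ω ^ q ∂M.μ x := by rw [hcov]; simp
    _ ≤ ∫⁻ ω in (⋃ k, C M A k), M.tau A ω ^ q ∂M.μ x
        + ∫⁻ ω in ⋂ n, B M A n, M.tau A ω ^ q ∂M.μ x := lintegral_union_le _ _ _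
    _ = ∫⁻ ω in (⋃ k, C M A k), M.tau A ω ^ q ∂M.μ x := by
        rw [setLIntegral_measure_zero _ _ hnev, add_zero]
    _ ≤ ∑' k, ∫⁻ ω in C M A k, M.tau A ω ^ q ∂M.μ x := lintegral_iUnion_le _ _
    _ ≤ _ := by
        refine ENNReal.tsum_le_tsum fun k => setLIntegral_mono' (measC M A k) fun ω hω => ?_
        refine le_trans ?_ (hb _ _ (J_nonneg M k ω))
        exact ENNReal.rpow_le_rpow (tau_le M A k ω hω) hq.le

lemma P_hasSum (x : M.X) : HasSum (fun y => M.P x y) 1 := by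
  have h := (M.γ_sum x).div_const (M.γ x)
  rw [div_self (M.γ_pos x).ne'] at h
  have e : (fun y => M.P x y) = fun y => (if y = x then 0 else M.Γ x y) / M.γ x := by
    funext y
    unfold CTMC.P
    split_ifs <;> simp
  rw [e]
  exact h

lemma Pg_hasSum (x : M.X) (g : M.X → ℝ) (hg : M.InDom g) :
    HasSum (fun y => M.P x y * g y) (g x + M.gen g x / M.γ x) := by
  have h := ((hg x).hasSum).div_const (M.γ x)
  have hγ := (M.γ_pos x).ne'
  have e : (∑' y, if y = x then 0 else M.Γ x y * g y) / M.γ x = g x + M.gen g x / M.γ x := by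
    unfold CTMC.gen
    field_simp
    ring
  rw [e] at h
  have e2 : (fun y => M.P x y * g y) = fun y => (if y = x then 0 else M.Γ x y * g y) / M.γ x := by
    funext y
    unfold CTMC.P
    split_ifs
    · simp
    · ring
  rw [e2]
  exact h

lemma drift (x : M.X) (g : M.X → ℝ) (hg : M.InDom g) (W : M.X → ℝ) (α β r : ℝ)
    (hW0 : ∀ y, 0 ≤ W y) (hW : ∀ y, W y ≤ α + β * g y)
    (hr : α + β * (g x + M.gen g x / M.γ x) ≤ r) :
    ∑' y, ENNReal.ofReal (M.P x y) * ENNReal.ofReal (W y) ≤ ENNReal.ofReal r := by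
  have hs : HasSum (fun y => M.P x y * (α + β * g y)) (α + β * (g x + M.gen g x / M.γ x)) := by
    have := ((P_hasSum M x).mul_left α).add ((Pg_hasSum M x g hg).mul_left β)
    rw [mul_one] at this
    have e2 : (fun y => M.P x y * (α + β * g y)) =
        fun y => α * M.P x y + β * (M.P x y * g y) := by
      funext y
      ring
    rw [e2]
    exact this
  calc ∑' y, ENNReal.ofReal (M.P x y) * ENNReal.ofReal (W y)
      ≤ ∑' y, ENNReal.ofReal (M.P x y * (α + β * g y)) := by
        refine ENNReal.tsum_le_tsum fun y => ?_
        rw [← ENNReal.ofReal_mul (P_nonneg M x y)]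
        exact ENNReal.ofReal_le_ofReal (mul_le_mul_of_nonneg_left (hW y) (P_nonneg M x y))
    _ = ENNReal.ofReal (∑' y, M.P x y * (α + β * g y)) := by
        rw [ENNReal.ofReal_tsum_of_nonneg _ hs.summable]
        exact fun y => mul_nonneg (P_nonneg M x y) ((hW0 y).trans (hW y))
    _ ≤ _ := by
        rw [hs.tsum_eq]
        exact ENNReal.ofReal_le_ofReal hr

lemma ftc {h h' : ℝ → ℝ} (hd : ∀ s, 0 ≤ s → HasDerivAt h (h' s) s) (hn : ∀ s, 0 ≤ s → h' s ≤ 0)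
    (h0 : ∀ s, 0 ≤ s → 0 ≤ h s) :
    ∫⁻ s in Ioi 0, ENNReal.ofReal (- h' s) ≤ ENNReal.ofReal (h 0) := by
  have hanti : AntitoneOn h (Ici 0) := by
    apply antitoneOn_of_deriv_nonpos (convex_Ici 0)
    · exact fun s hs => (hd s hs).continuousAt.continuousWithinAt
    · intro s hs
      rw [interior_Ici] at hs
      exact (hd s (le_of_lt hs)).differentiableAt.differentiableWithinAt
    · intro s hs
      rw [interior_Ici] at hs
      rw [(hd s (le_of_lt hs)).deriv]
      exact hn s (le_of_lt hs)
  have hanti' : Antitone (fun s => h (max s 0)) := fun s t hst =>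
    hanti (mem_Ici.2 (le_max_right _ _)) (mem_Ici.2 (le_max_right _ _)) (max_le_max hst le_rfl)
  have hbdd : BddBelow (range fun s => h (max s 0)) :=
    ⟨0, by rintro _ ⟨s, rfl⟩; exact h0 _ (le_max_right _ _)⟩
  have hl := tendsto_atTop_ciInf hanti' hbdd
  have hl0 : 0 ≤ ⨅ s, h (max s 0) := le_ciInf fun s => h0 _ (le_max_right _ _)
  have hl' : Tendsto h atTop (nhds (⨅ s, h (max s 0))) := by
    refine hl.congr' ?_
    filter_upwards [eventually_ge_atTop 0] with s hs
    rw [max_eq_left hs]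
  have hIcc := integrableOn_Ioi_deriv_of_nonpos' (fun s hs => hd s hs) (fun s hs => hn s (le_of_lt hs)) hl'
  have heq := integral_Ioi_of_hasDerivAt_of_nonpos' (fun s hs => hd s hs) (fun s hs => hn s (le_of_lt hs)) hl'
  have hIcc2 : IntegrableOn (fun s => - h' s) (Ioi 0) volume := hIcc.neg
  rw [← ofReal_integral_eq_lintegral_ofReal hIcc2]
  · rw [integral_neg, heq]
    exact ENNReal.ofReal_le_ofReal (by linarith)
  · filter_upwards [ae_restrict_mem measurableSet_Ioi] with s hs
    have := hn s (le_of_lt hs)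
    simp only [Pi.zero_apply]
    linarith

lemma super_of_deriv (x : M.X) (V : M.X → ℝ → ℝ) (hV : ∀ y, Measurable (V y))
    (hV0 : ∀ t, 0 ≤ t → 0 ≤ V x t)
    (e : ℝ → ℝ) (hd : ∀ t, 0 ≤ t → HasDerivAt (V x) (e t) t)
    (hpos : ∀ t, 0 ≤ t → 0 ≤ V x t - e t / M.γ x)
    (hdr : ∀ t, 0 ≤ t → ∑' y, ENNReal.ofReal (M.P x y) * ENNReal.ofReal (V y t)
      ≤ ENNReal.ofReal (V x t - e t / M.γ x)) (t : ℝ) (ht : 0 ≤ t) :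
    Q M (fun y t => ENNReal.ofReal (V y t)) x t ≤ ENNReal.ofReal (V x t) := by
  have hγ := M.γ_pos x
  unfold Q
  rw [lintegral_expM]
  · let h : ℝ → ℝ := fun s => Real.exp (-M.γ x * s) * V x (t + s)
    let h' : ℝ → ℝ := fun s => -(M.γ x * Real.exp (-M.γ x * s) *
      (V x (t + s) - e (t + s) / M.γ x))
    have hh : ∀ s, 0 ≤ s → HasDerivAt h (h' s) s := by
      intro s hs
      have h1 : HasDerivAt (fun s => Real.exp (-M.γ x * s)) (Real.exp (-M.γ x * s) * (-M.γ x)) s := by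
        have := ((hasDerivAt_id s).const_mul (-M.γ x)).exp
        simpa using this
      have h2 : HasDerivAt (fun s => V x (t + s)) (e (t + s)) s :=
        HasDerivAt.comp_const_add t s (hd (t + s) (by linarith))
      refine (h1.mul h2).congr_deriv ?_
      change _ = -(M.γ x * Real.exp (-M.γ x * s) * (V x (t + s) - e (t + s) / M.γ x))
      field_simp
      ring
    have := ftc hh (fun s hs => by
        have := hpos (t + s) (by linarith)
        simp only [h']
        have : 0 ≤ M.γ x * Real.exp (-M.γ x * s) * (V x (t + s) - e (t + s) / M.γ x) := by positivity
        linarith) (fun s hs => mul_nonneg (Real.exp_pos _).le (hV0 _ (by linarith)))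
    simp only [h, h', mul_zero, Real.exp_zero, one_mul, add_zero, neg_neg] at this
    refine le_trans ?_ this
    refine setLIntegral_mono' measurableSet_Ioi fun s hs => ?_
    have hs' : 0 < s := hs
    rw [ENNReal.ofReal_mul (p := M.γ x * Real.exp (-M.γ x * s)) (by positivity)]
    exact mul_le_mul' le_rfl (hdr (t + s) (by linarith))
  · refine Measurable.tsum fun y => ?_
    have := hV y
    fun_prop

/-- superharmonicity off `A` -/
def Super (A : Set M.X) (V : M.X → ℝ → ℝ≥0∞) : Prop :=
  (∀ y, Measurable (V y)) ∧ ∀ y, y ∉ A → ∀ t, 0 ≤ t → Q M V y t ≤ V y t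

lemma super_const (A : Set M.X) (r : ℝ≥0∞) : Super M A (fun _ _ => r) := by
  refine ⟨fun y => measurable_const, fun y _ t _ => ?_⟩
  unfold Q
  dsimp only
  rw [ENNReal.tsum_mul_right, ← ENNReal.ofReal_tsum_of_nonneg (P_nonneg M y) (P_hasSum M y).summable,
    (P_hasSum M y).tsum_eq]
  simp [expM_univ (M.γ_pos y)]

lemma super_tsum (A : Set M.X) (V : ℕ → M.X → ℝ → ℝ≥0∞) (w : ℕ → ℝ≥0∞)
    (h : ∀ i, Super M A (V i)) : Super M A (fun y t => ∑' i, w i * V i y t) := by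
  refine ⟨fun y => Measurable.tsum fun i => ((h i).1 y).const_mul _, fun y hy t ht => ?_⟩
  have : Q M (fun y t => ∑' i, w i * V i y t) y t = ∑' i, w i * Q M (V i) y t := by
    unfold Q
    have hm : ∀ i, Measurable fun s => ∑' y', ENNReal.ofReal (M.P y y') * V i y' (t + s) := by
      intro i
      refine Measurable.tsum fun y' => ?_
      have := (h i).1 y'
      fun_prop
    simp_rw [← lintegral_const_mul _ (hm _)]
    rw [← lintegral_tsum (fun i => ((hm i).const_mul _).aemeasurable)]
    refine lintegral_congr fun s => ?_
    simp_rw [← ENNReal.tsum_mul_left]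
    rw [ENNReal.tsum_comm]
    refine tsum_congr fun i => tsum_congr fun y' => ?_
    ring
  rw [this]
  exact ENNReal.tsum_le_tsum fun i => mul_le_mul' le_rfl ((h i).2 y hy t ht)

lemma super_add (A : Set M.X) (V W : M.X → ℝ → ℝ≥0∞) (r : ℝ≥0∞)
    (hV : Super M A V) (hW : Super M A W) : Super M A (fun y t => V y t + r * W y t) := by
  refine ⟨fun y => (hV.1 y).add ((hW.1 y).const_mul _), fun y hy t ht => ?_⟩
  have : Q M (fun y t => V y t + r * W y t) y t = Q M V y t + r * Q M W y t := by
    unfold Q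
    have hm1 : Measurable fun s => ∑' y', ENNReal.ofReal (M.P y y') * V y' (t + s) := by
      refine Measurable.tsum fun y' => ?_
      have := hV.1 y'
      fun_prop
    have hm2 : Measurable fun s => ∑' y', ENNReal.ofReal (M.P y y') * W y' (t + s) := by
      refine Measurable.tsum fun y' => ?_
      have := hW.1 y'
      fun_prop
    rw [← lintegral_const_mul _ hm2, ← lintegral_add_left hm1]
    refine lintegral_congr fun s => ?_
    rw [← ENNReal.tsum_mul_left, ← ENNReal.tsum_add]
    refine tsum_congr fun y' => ?_
    ring
  rw [this]
  exact add_le_add (hV.2 y hy t ht) (mul_le_mul' le_rfl (hW.2 y hy t ht))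

lemma tangent {w z b r : ℝ} (hw : 0 < w) (hz : 0 ≤ z) (hb : 0 ≤ b) (hr : 1 ≤ r) :
    (z + b) ^ r ≤ (w + b) ^ (r - 1) * (b + w ^ (1 - r) * z ^ r) := by
  have hwb : 0 < w + b := by linarith
  have hzw : 0 ≤ z / w := by positivity
  have hw1 : 0 ≤ b / (w + b) := by positivity
  have hw2 : 0 ≤ w / (w + b) := by positivity
  have h := (convexOn_rpow hr).2 (mem_Ici.2 zero_le_one) (mem_Ici.2 hzw) hw1 hw2
    (by field_simp; ring)
  simp only [smul_eq_mul, Real.one_rpow, mul_one] at h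
  have e1 : b / (w + b) + w / (w + b) * (z / w) = (z + b) / (w + b) := by field_simp; ring
  rw [e1, Real.div_rpow (by linarith) hwb.le, Real.div_rpow hz hw.le,
    div_le_iff₀ (by positivity)] at h
  refine h.trans (le_of_eq ?_)
  rw [Real.rpow_sub hwb, Real.rpow_sub hw, Real.rpow_one, Real.rpow_one]
  field_simp

lemma super_of_main (x : M.X) (g : M.X → ℝ) (hg : M.InDom g) (V : M.X → ℝ → ℝ)
    (hV : ∀ y, Measurable (V y)) (hV0 : ∀ y t, 0 ≤ t → 0 ≤ V y t)
    (e : ℝ → ℝ) (hd : ∀ t, 0 ≤ t → HasDerivAt (V x) (e t) t)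
    (main : ∀ t, 0 ≤ t → ∃ α β : ℝ, (∀ y, V y t ≤ α + β * g y) ∧
      α + β * (g x + M.gen g x / M.γ x) ≤ V x t - e t / M.γ x) (t : ℝ) (ht : 0 ≤ t) :
    Q M (fun y t => ENNReal.ofReal (V y t)) x t ≤ ENNReal.ofReal (V x t) := by
  refine super_of_deriv M x V hV (hV0 x) e hd ?_ ?_ t ht
  · intro t ht
    obtain ⟨α, β, h1, h2⟩ := main t ht
    refine le_trans ?_ h2
    have hs : HasSum (fun y => M.P x y * (α + β * g y))
        (α + β * (g x + M.gen g x / M.γ x)) := by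
      have := ((P_hasSum M x).mul_left α).add ((Pg_hasSum M x _ hg).mul_left β)
      rw [mul_one] at this
      have e2 : (fun y => M.P x y * (α + β * g y)) =
          fun y => α * M.P x y + β * (M.P x y * g y) := by
        funext y
        ring
      rw [e2]
      exact this
    exact hs.nonneg fun y => mul_nonneg (P_nonneg M x y) ((hV0 y t ht).trans (h1 y))
  · intro t ht
    obtain ⟨α, β, h1, h2⟩ := main t ht
    exact drift M x _ hg _ α β _ (fun y => hV0 y t ht) h1 h2

section lyap

lemma never (f : M.X → ℝ) (a c p : ℝ) (hf0 : ∀ x, 0 ≤ f x) (ha : 0 < a) (hc : 0 < c) (hp : 0 < p)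
    (hfp : M.InDom fun x => f x ^ p)
    (hdrift : ∀ x : M.X, a < f x → M.gen (fun y => f y ^ p) x ≤ -c * f x ^ (p - 2))
    (hfinf : M.FinSublevels f) (x : M.X) : M.μ x (⋂ n, B M {y | f y ≤ a} n) = 0 := by
  refine never_zero M _ x (fun y => ENNReal.ofReal (f y ^ p))
    (fun y => ENNReal.ofReal (c * f y ^ (p - 2) / M.γ y)) (by simp) ?_ ?_ ?_
  · intro y hy
    have hy' : a < f y := not_le.1 hy
    have h0 : 0 < f y := ha.trans hy'
    have := M.γ_pos y
    have : 0 < c * f y ^ (p - 2) / M.γ y := by positivity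
    simpa using this
  · intro y hy t ht
    have hy' : a < f y := not_le.1 hy
    have h0 : 0 < f y := ha.trans hy'
    have hγ := M.γ_pos y
    have h1 : 0 ≤ c * f y ^ (p - 2) / M.γ y := by positivity
    have h2 : M.gen (fun y => f y ^ p) y / M.γ y ≤ - (c * f y ^ (p - 2) / M.γ y) := by
      rw [← neg_div, ← neg_mul]
      exact div_le_div_of_nonneg_right (hdrift y hy') hγ.le
    have h3 : 0 ≤ f y ^ p + M.gen (fun y => f y ^ p) y / M.γ y :=
      (Pg_hasSum M y _ hfp).nonneg fun z => mul_nonneg (P_nonneg M y z) (Real.rpow_nonneg (hf0 z) _)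
    have h4 : Q M (fun y _ => ENNReal.ofReal (f y ^ p)) y t
        ≤ ENNReal.ofReal (f y ^ p + M.gen (fun y => f y ^ p) y / M.γ y) := by
      unfold Q
      rw [lintegral_const, expM_univ hγ, mul_one]
      exact drift M y _ hfp _ 0 1 _ (fun z => Real.rpow_nonneg (hf0 z) _) (by simp) (by simp)
    refine (add_le_add h4 le_rfl).trans ?_
    rw [← ENNReal.ofReal_add h3 h1]
    exact ENNReal.ofReal_le_ofReal (by linarith)
  · intro R
    refine (hfinf ((R:ℝ) ^ (1 / p))).subset fun y hy => ?_
    have hy' : ENNReal.ofReal (f y ^ p) ≤ R := hy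
    rw [← ENNReal.ofReal_natCast, ENNReal.ofReal_le_ofReal_iff (by positivity)] at hy'
    have := Real.rpow_le_rpow (Real.rpow_nonneg (hf0 y) _) hy' (by positivity : 0 ≤ 1 / p)
    rwa [← Real.rpow_mul (hf0 y), mul_one_div_cancel hp.ne', Real.rpow_one] at this

lemma super_large (f : M.X → ℝ) (a c p : ℝ) (hf0 : ∀ x, 0 ≤ f x) (ha : 0 < a) (hc : 0 < c) (hp : 0 < p)
    (hfp : M.InDom fun x => f x ^ p)
    (hdrift : ∀ x : M.X, a < f x → M.gen (fun y => f y ^ p) x ≤ -c * f x ^ (p - 2))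
    (hp2 : 2 ≤ p) : Super M {y | f y ≤ a}
    (fun y t => ENNReal.ofReal ((f y ^ 2 + 2 * c / p * t) ^ (p / 2))) := by
  have hm : ∀ y, Measurable fun t => (f y ^ 2 + 2 * c / p * t) ^ (p / 2) := fun y => by fun_prop
  refine ⟨fun y => (hm y).ennreal_ofReal, fun x hx => ?_⟩
  have hx' : a < f x := not_le.1 hx
  have h0 : 0 < f x := ha.trans hx'
  have hγ := M.γ_pos x
  have hk : 0 < 2 * c / p := by positivity
  have main : ∀ t, 0 ≤ t → ∃ α β : ℝ,
      (∀ y, (f y ^ 2 + 2 * c / p * t) ^ (p / 2) ≤ α + β * f y ^ p) ∧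
      α + β * (f x ^ p + M.gen (fun y => f y ^ p) x / M.γ x) ≤ (f x ^ 2 + 2 * c / p * t) ^ (p / 2)
        - c * (f x ^ 2 + 2 * c / p * t) ^ (p / 2 - 1) / M.γ x := by
    intro t ht
    have hS : 0 < f x ^ 2 + 2 * c / p * t := by positivity
    have hfx : (f x ^ 2) ^ (1 - p / 2) = f x ^ (2 - p) := by
      rw [← Real.rpow_natCast, ← Real.rpow_mul h0.le]
      congr 1
      push_cast
      ring
    refine ⟨(f x ^ 2 + 2 * c / p * t) ^ (p / 2 - 1) * (2 * c / p * t),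
      (f x ^ 2 + 2 * c / p * t) ^ (p / 2 - 1) * f x ^ (2 - p), ?_, ?_⟩
    · intro y
      have h := tangent (w := f x ^ 2) (z := f y ^ 2) (b := 2 * c / p * t) (r := p / 2)
        (by positivity) (by positivity) (by positivity) (by linarith)
      have hfy : (f y ^ 2) ^ (p / 2) = f y ^ p := by
        rw [← Real.rpow_natCast, ← Real.rpow_mul (hf0 y)]
        congr 1
        push_cast
        ring
      rw [hfx, hfy] at h
      refine h.trans (le_of_eq ?_)
      ring
    · have hd := hdrift x hx'
      set S := f x ^ 2 + 2 * c / p * t with hSdef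
      have e1 : f x ^ (2 - p) * f x ^ p = f x ^ 2 := by
        rw [← Real.rpow_add h0, ← Real.rpow_natCast]
        congr 1
        push_cast
        ring
      have e2 : f x ^ (2 - p) * f x ^ (p - 2) = 1 := by
        rw [← Real.rpow_add h0]
        simp
      have e3 : S ^ (p / 2) = S ^ (p / 2 - 1) * S := by
        rw [← Real.rpow_add_one hS.ne']
        congr 1
        ring
      have h5 : f x ^ (2 - p) * (M.gen (fun y => f y ^ p) x / M.γ x) ≤ - c / M.γ x := by
        rw [← mul_div_assoc]
        refine div_le_div_of_nonneg_right ?_ hγ.le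
        calc _ ≤ f x ^ (2 - p) * (-c * f x ^ (p - 2)) := by gcongr
          _ = -c * (f x ^ (2 - p) * f x ^ (p - 2)) := by ring
          _ = -c := by rw [e2, mul_one]
      rw [e3]
      calc _ = S ^ (p / 2 - 1) * (2 * c / p * t + f x ^ (2 - p) * f x ^ p +
            f x ^ (2 - p) * (M.gen (fun y => f y ^ p) x / M.γ x)) := by ring
        _ ≤ S ^ (p / 2 - 1) * (2 * c / p * t + f x ^ 2 + - c / M.γ x) := by
            rw [e1]; gcongr
        _ = _ := by rw [hSdef]; ring
  have hd : ∀ t, 0 ≤ t → HasDerivAt (fun t => (f x ^ 2 + 2 * c / p * t) ^ (p / 2))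
      (c * (f x ^ 2 + 2 * c / p * t) ^ (p / 2 - 1)) t := by
    intro t ht
    have hS : 0 < f x ^ 2 + 2 * c / p * t := by positivity
    have h1 : HasDerivAt (fun t => f x ^ 2 + 2 * c / p * t) (2 * c / p) t := by
      have := ((hasDerivAt_id t).const_mul (2 * c / p)).const_add (f x ^ 2)
      simpa using this
    refine (h1.rpow_const (p := p / 2) (Or.inl hS.ne')).congr_deriv ?_
    field_simp
  refine super_of_main M x _ hfp (fun y t => (f y ^ 2 + 2 * c / p * t) ^ (p / 2)) hm
    (fun y t ht => by positivity) _ hd main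

lemma psi_deriv (z : ℝ) : HasDerivAt (fun z : ℝ => 1 - (max (1 - z) 0) ^ 2) (2 * max (1 - z) 0) z := by
  rcases lt_trichotomy z 1 with h | h | h
  · have h1 : HasDerivAt (fun z : ℝ => 1 - (1 - z) ^ 2) (2 * (1 - z)) z := by
      have := (((hasDerivAt_id z).const_sub 1).pow 2).const_sub 1
      refine this.congr_deriv ?_
      simp
    rw [max_eq_left (by linarith)]
    refine h1.congr_of_eventuallyEq ?_
    filter_upwards [Iio_mem_nhds h] with y hy
    have hy' : y < 1 := hy
    rw [max_eq_left (by linarith)]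
  · subst h
    rw [hasDerivAt_iff_isLittleO_nhds_zero]
    simp only [sub_self, max_self, mul_zero, smul_eq_mul]
    have h2 : (fun h : ℝ => h ^ 2) =o[nhds 0] fun h => h := by
      simpa using! (Asymptotics.isLittleO_pow_pow (𝕜 := ℝ) (m := 1) (n := 2) (by norm_num))
    refine Asymptotics.IsBigO.trans_isLittleO ?_ h2
    refine Asymptotics.IsBigO.of_bound 1 (Eventually.of_forall fun y => ?_)
    have e : (1 - max (1 - (1 + y)) 0 ^ 2 - (1 - (0:ℝ) ^ 2) - 0) = - max (-y) 0 ^ 2 := by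
      have : 1 - (1 + y) = -y := by ring
      rw [this]
      ring
    rw [e, norm_neg, one_mul, Real.norm_of_nonneg (by positivity), Real.norm_of_nonneg (by positivity)]
    rcases le_total (-y) 0 with hy | hy
    · rw [max_eq_right hy]; nlinarith [sq_nonneg y]
    · rw [max_eq_left hy]; simp
  · have h1 : HasDerivAt (fun _ : ℝ => (1:ℝ)) 0 z := hasDerivAt_const _ _
    rw [max_eq_right (by linarith), mul_zero]
    refine h1.congr_of_eventuallyEq ?_
    filter_upwards [Ioi_mem_nhds h] with y hy
    have hy' : 1 < y := hy
    rw [max_eq_right (by linarith)]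
    simp

lemma psi_tangent (z w : ℝ) : 1 - (max (1 - w) 0) ^ 2 ≤
    1 - (max (1 - z) 0) ^ 2 + 2 * max (1 - z) 0 * (w - z) := by
  have h1 := le_max_left (1 - w) 0
  have h2 := le_max_right (1 - w) 0
  have h3 := le_max_right (1 - z) 0
  rcases max_cases (1 - z) 0 with ⟨h, h'⟩ | ⟨h, h'⟩
  · rw [h] at h3 ⊢
    nlinarith [sq_nonneg (max (1 - w) 0 - (1 - z))]
  · rw [h]
    nlinarith [sq_nonneg (max (1 - w) 0)]

lemma super_small (f : M.X → ℝ) (a c p : ℝ) (hf0 : ∀ x, 0 ≤ f x) (ha : 0 < a) (hc : 0 < c) (hp : 0 < p)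
    (hfp : M.InDom fun x => f x ^ p)
    (hdrift : ∀ x : M.X, a < f x → M.gen (fun y => f y ^ p) x ≤ -c * f x ^ (p - 2))
    (hp2 : p ≤ 2) (T : ℝ) (hT : 0 < T) : Super M {y | f y ≤ a}
    (fun y t => ENNReal.ofReal
      (1 - (max (1 - ((1 / (c * T)) ^ (p / 2) * f y ^ p + t / T)) 0) ^ 2)) := by
  set b := (1 / (c * T)) ^ (p / 2) with hb
  have hb0 : 0 < b := by positivity
  have hm : ∀ y, Measurable fun t => (1 - (max (1 - (b * f y ^ p + t / T)) 0) ^ 2) := fun y => by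
    fun_prop
  refine ⟨fun y => (hm y).ennreal_ofReal, fun x hx => ?_⟩
  have hx' : a < f x := not_le.1 hx
  have h0 : 0 < f x := ha.trans hx'
  have hγ := M.γ_pos x
  refine super_of_main M x _ hfp (fun y t => 1 - (max (1 - (b * f y ^ p + t / T)) 0) ^ 2) hm
    ?_ (fun t => 2 * max (1 - (b * f x ^ p + t / T)) 0 * (1 / T)) ?_ ?_
  · intro y t ht
    have h1 : 0 ≤ b * f y ^ p + t / T := by
      have := hf0 y
      positivity
    have h2 : max (1 - (b * f y ^ p + t / T)) 0 ≤ 1 := max_le (by linarith) zero_le_one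
    have h3 := le_max_right (1 - (b * f y ^ p + t / T)) 0
    have := pow_le_one₀ (n := 2) h3 h2
    linarith
  · intro t ht
    have h1 : HasDerivAt (fun t => b * f x ^ p + t / T) (1 / T) t := by
      simpa using ((hasDerivAt_id t).div_const T).const_add (b * f x ^ p)
    have h2 := HasDerivAt.comp t (psi_deriv (b * f x ^ p + t / T)) h1
    exact h2
  · intro t ht
    set z := b * f x ^ p + t / T with hz
    set d := 2 * max (1 - z) 0 with hd
    have hd0 : 0 ≤ d := by positivity
    refine ⟨1 - (max (1 - z) 0) ^ 2 - d * (b * f x ^ p), d * b, fun y => ?_, ?_⟩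
    · refine (psi_tangent z (b * f y ^ p + t / T)).trans (le_of_eq ?_)
      rw [← hd, hz]
      ring
    · have hg := hdrift x hx'
      have key : d * (1 / T) ≤ d * (b * (c * f x ^ (p - 2))) := by
        rcases le_or_gt 1 z with h1 | h1
        · have : d = 0 := by rw [hd, max_eq_right (by linarith), mul_zero]
          rw [this]; simp
        · refine mul_le_mul_of_nonneg_left ?_ hd0
          have h2 : b * f x ^ p < 1 := by
            have : 0 ≤ t / T := by positivity
            linarith
          set r := f x ^ 2 / (c * T) with hr
          have hr0 : 0 < r := by positivity
          have e1 : b * f x ^ p = r ^ (p / 2) := by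
            rw [hr, div_eq_mul_one_div, Real.mul_rpow (by positivity) (by positivity), ← hb,
              ← Real.rpow_natCast, ← Real.rpow_mul h0.le, mul_comm]
            congr 2
            push_cast
            ring
          have hr1 : r < 1 := by
            by_contra h
            have := Real.one_le_rpow (not_lt.1 h) (by positivity : 0 ≤ p / 2)
            linarith
          have e2 : b * (c * f x ^ (p - 2)) = r ^ (p / 2 - 1) * (1 / T) := by
            rw [Real.rpow_sub hr0, Real.rpow_one, ← e1, Real.rpow_sub h0, hr, Real.rpow_two]
            field_simp
          rw [e2]
          have := Real.one_le_rpow_of_pos_of_le_one_of_nonpos hr0 hr1.le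
            (by linarith : p / 2 - 1 ≤ 0)
          have hT' : 0 < 1 / T := by positivity
          nlinarith
      have h5 : d * b * (M.gen (fun y => f y ^ p) x / M.γ x) ≤ -(d * (1 / T) / M.γ x) := by
        rw [← mul_div_assoc, ← neg_div]
        refine div_le_div_of_nonneg_right ?_ hγ.le
        have : d * b * M.gen (fun y => f y ^ p) x ≤ d * b * (-c * f x ^ (p - 2)) := by gcongr
        linarith
      linarith

end lyap

lemma rpow_le_one_add {t q r : ℝ} (ht : 0 ≤ t) (hq : 0 < q) (hqr : q ≤ r) : t ^ q ≤ 1 + t ^ r := by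
  rcases le_total t 1 with h | h
  · have := Real.rpow_le_one ht h hq.le
    have := Real.rpow_nonneg ht r
    linarith
  · have := Real.rpow_le_rpow_of_exponent_le h hqr
    linarith

end CTMCAux

open CTMC in
/-- Theorem (moments of passage times, part 1): if `Γ f^p ≤ -c f^(p-2)` outside
the sublevel set `{f ≤ a}`, then `E_x (τ_{{f ≤ a}}^q) < ∞` for all `0 < q < p/2`. -/
theorem statement0 (M : CTMC) (f : M.X → ℝ)
    (hf : M.InDomPos f) (hfinf : M.FinSublevels f)
    (a c p : ℝ) (ha : 0 < a) (hc : 0 < c) (hp : 0 < p)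
    (hfp : M.InDomPos fun x => f x ^ p)
    (hdrift : ∀ x : M.X, a < f x → M.gen (fun y => f y ^ p) x ≤ -c * f x ^ (p - 2)) :
    ∀ q : ℝ, 0 < q → q < p / 2 → ∀ x : M.X,
      ∫⁻ ω, M.tau {y | f y ≤ a} ω ^ q ∂ M.μ x < ⊤ := by
  intro q hq hqp x
  have hnev := CTMCAux.never M f a c p hf.1 ha hc hp hfp.2 hdrift hfinf x
  rcases le_total 2 p with hp2 | hp2
  · have hS := CTMCAux.super_large M f a c p hf.1 ha hc hp hfp.2 hdrift hp2
    have hk : 0 < 2 * c / p := by positivity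
    have hS' := CTMCAux.super_add M _ _ _ (ENNReal.ofReal (((2 * c / p) ^ (p / 2))⁻¹))
      (CTMCAux.super_const M {y | f y ≤ a} 1) hS
    refine lt_of_le_of_lt (CTMCAux.main_bound M _ x q hq hnev hS'.1 hS'.2 ?_) ?_
    · intro y t ht
      rw [ENNReal.ofReal_rpow_of_nonneg ht hq.le, ← ENNReal.ofReal_mul (by positivity),
        ← ENNReal.ofReal_one, ← ENNReal.ofReal_add zero_le_one (by positivity)]
      refine ENNReal.ofReal_le_ofReal ?_
      refine (CTMCAux.rpow_le_one_add ht hq hqp.le).trans ?_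
      have h1 : (2 * c / p * t) ^ (p / 2) ≤ (f y ^ 2 + 2 * c / p * t) ^ (p / 2) := by
        refine Real.rpow_le_rpow (by positivity) ?_ (by positivity)
        have := sq_nonneg (f y)
        linarith
      rw [Real.mul_rpow hk.le ht] at h1
      have h2 : 0 < (2 * c / p) ^ (p / 2) := by positivity
      have : t ^ (p / 2) ≤ ((2 * c / p) ^ (p / 2))⁻¹ * (f y ^ 2 + 2 * c / p * t) ^ (p / 2) := by
        rw [inv_mul_eq_div, le_div_iff₀ h2]
        linarith
      linarith
    · exact ENNReal.add_lt_top.2 ⟨by simp, ENNReal.mul_lt_top (by simp) (by simp)⟩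
  · have hS := fun n : ℕ => CTMCAux.super_small M f a c p hf.1 ha hc hp hfp.2 hdrift hp2
      ((2:ℝ) ^ n) (by positivity)
    have hS' := CTMCAux.super_add M _ _ _ 1 (CTMCAux.super_const M {y | f y ≤ a} 1)
      (CTMCAux.super_tsum M _ _ (fun n => ENNReal.ofReal (((2:ℝ) ^ (n + 1)) ^ q)) hS)
    refine lt_of_le_of_lt (CTMCAux.main_bound M _ x q hq hnev hS'.1 hS'.2 ?_) ?_
    · intro y t ht
      rw [ENNReal.ofReal_rpow_of_nonneg ht hq.le]
      rcases le_or_gt 1 t with h1 | h1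
      · refine le_trans ?_ le_add_self
        rw [one_mul]
        obtain ⟨n, hn1, hn2⟩ := exists_nat_pow_near h1 (one_lt_two)
        refine le_trans ?_ (ENNReal.le_tsum n)
        have hz : 1 ≤ (1 / (c * 2 ^ n)) ^ (p / 2) * f y ^ p + t / 2 ^ n := by
          have h3 : 1 ≤ t / 2 ^ n := by
            rw [le_div_iff₀ (by positivity)]
            linarith
          have h4 : 0 ≤ (1 / (c * 2 ^ n)) ^ (p / 2) * f y ^ p := 
            mul_nonneg (by positivity) (hfp.1 y)
          linarith
        rw [max_eq_right (by linarith)]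
        simp only [ne_eq, OfNat.ofNat_ne_zero, not_false_eq_true, zero_pow, sub_zero,
          ENNReal.ofReal_one, mul_one]
        exact ENNReal.ofReal_le_ofReal (Real.rpow_le_rpow ht hn2.le hq.le)
      · refine le_trans ?_ le_self_add
        rw [← ENNReal.ofReal_one]
        exact ENNReal.ofReal_le_ofReal (Real.rpow_le_one ht h1.le hq.le)
    · refine ENNReal.add_lt_top.2 ⟨by simp, ENNReal.mul_lt_top (by simp) ?_⟩
      set K := 2 * (2:ℝ) ^ q * (1 / c) ^ (p / 2) * f x ^ p with hK
      have hK0 : 0 ≤ K := mul_nonneg (by positivity) (hfp.1 x)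
      set ρ := (2:ℝ) ^ (q - p / 2) with hρ
      have hρ0 : 0 < ρ := by positivity
      have hρ1 : ρ < 1 := Real.rpow_lt_one_of_one_lt_of_neg one_lt_two (by linarith)
      have hsum : Summable fun n : ℕ => K * ρ ^ n :=
        (summable_geometric_of_lt_one hρ0.le hρ1).mul_left K
      refine lt_of_le_of_lt (ENNReal.tsum_le_tsum (g := fun n => ENNReal.ofReal (K * ρ ^ n))
        fun n => ?_) ?_
      · rw [← ENNReal.ofReal_mul (by positivity)]
        refine ENNReal.ofReal_le_ofReal ?_
        have ht := CTMCAux.psi_tangent 0 ((1 / (c * 2 ^ n)) ^ (p / 2) * f x ^ p + 0 / 2 ^ n)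
        simp only [sub_zero, zero_div, add_zero, zero_le_one, sup_of_le_left, one_pow, sub_self,
          mul_one, zero_add] at ht
        simp only [zero_div, add_zero]
        refine (mul_le_mul_of_nonneg_left ht (by positivity)).trans (le_of_eq ?_)
        have e1 : ((2:ℝ) ^ (n + 1)) ^ q = 2 ^ q * (2 ^ q) ^ n := by
          rw [pow_succ, Real.mul_rpow (by positivity) (by positivity), ← Real.rpow_natCast,
            ← Real.rpow_natCast, ← Real.rpow_mul (by positivity), ← Real.rpow_mul (by positivity),
            mul_comm (n:ℝ) q, mul_comm]
        have e2 : (1 / (c * 2 ^ n)) ^ (p / 2) = (1 / c) ^ (p / 2) * (((2:ℝ) ^ (p / 2)) ^ n)⁻¹ := by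
          rw [one_div, mul_inv, Real.mul_rpow (by positivity) (by positivity), one_div,
            Real.inv_rpow (by positivity) (p / 2), ← Real.rpow_natCast,
            ← Real.rpow_natCast, ← Real.rpow_mul (by positivity), Real.inv_rpow (by positivity),
            ← Real.rpow_mul (by positivity), mul_comm (n:ℝ) (p/2)]
        have e3 : ρ ^ n = (2 ^ q) ^ n * (((2:ℝ) ^ (p / 2)) ^ n)⁻¹ := by
          rw [hρ, Real.rpow_sub two_pos, div_pow, div_eq_mul_inv]
        rw [e1, e2, e3, hK]
        ring
      · rw [← ENNReal.ofReal_tsum_of_nonneg (fun n => by positivity) hsum]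
        exact ENNReal.ofReal_lt_top
end

section
/- Let f ∈ Dom_+(Γ) with f → ∞. Suppose there exists an increasing function g : [0,∞) → [0,∞) whose reciprocal is locally integrable with non-integrable tail, i.e. G(z) := ∫_0^z (1/g(y)) dy < ∞ for all z ≥ 0 and G(z) → ∞ as z → ∞, and suppose Γf(x) ≤ g(f(x)) for all x ∈ 𝕏. Then P_x(ζ = ∞) = 1 for all x ∈ 𝕏, i.e. the chain is non-explosive. -/
open MeasureTheory Set Filter
open scoped Classical ENNReal NNReal

namespace CTMCProof

/-- Laplace transform of an exponential tail. -/
lemma one_step {Ω : Type} [MeasurableSpace Ω] (ν : Measure Ω) (σ : Ω → ℝ) (hσ : Measurable σ)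
    (hpos : ∀ ω, 0 < σ ω) (c a : ℝ) (hc : 0 ≤ c) (ha : 0 < a)
    (h : ∀ t : ℝ, 0 ≤ t → ν {ω | t < σ ω} = ENNReal.ofReal (c * Real.exp (-a * t))) :
    ∫⁻ ω, ENNReal.ofReal (Real.exp (-σ ω)) ∂ν = ENNReal.ofReal (c * (a / (1 + a))) := by
  have huniv : ν univ = ENNReal.ofReal c := by
    have := h 0 le_rfl
    simpa [hpos] using this
  have hlc := lintegral_comp_eq_lintegral_meas_lt_mul ν (f := σ) (g := fun t => Real.exp (-t))
    (Eventually.of_forall fun ω => (hpos ω).le) hσ.aemeasurable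
    (fun t _ => (Real.continuous_exp.comp continuous_neg).intervalIntegrable _ _)
    (Eventually.of_forall fun t => (Real.exp_pos _).le)
  have h1 : ∀ s : ℝ, ∫ t in (0:ℝ)..s, Real.exp (-t) = 1 - Real.exp (-s) := by
    intro s
    rw [intervalIntegral.integral_comp_neg (fun t => Real.exp t)]
    simp
  simp only [h1] at hlc
  have hr : ∫⁻ t in Ioi (0:ℝ), ν {ω | t < σ ω} * ENNReal.ofReal (Real.exp (-t))
      = ENNReal.ofReal (c * (1 / (1 + a))) := by
    have e1 : ∫⁻ t in Ioi (0:ℝ), ν {ω | t < σ ω} * ENNReal.ofReal (Real.exp (-t))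
        = ∫⁻ t in Ioi (0:ℝ), ENNReal.ofReal (c * Real.exp (-(1 + a) * t)) := by
      refine setLIntegral_congr_fun measurableSet_Ioi fun t ht => ?_
      rw [h t (le_of_lt ht), ← ENNReal.ofReal_mul (by positivity), mul_assoc, ← Real.exp_add]
      congr 3; ring
    rw [e1, ← ofReal_integral_eq_lintegral_ofReal]
    · congr 1
      rw [integral_const_mul, integral_exp_mul_Ioi (by linarith)]
      simp
      left
      rw [inv_eq_one_div, div_eq_div_iff] <;> linarith
    · exact (integrableOn_exp_mul_Ioi (by linarith) 0).const_mul c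
    · exact Eventually.of_forall fun t => by positivity
  rw [hr] at hlc
  have hsum : ∫⁻ ω, ENNReal.ofReal (1 - Real.exp (-σ ω)) ∂ν
      + ∫⁻ ω, ENNReal.ofReal (Real.exp (-σ ω)) ∂ν = ENNReal.ofReal c := by
    rw [← lintegral_add_left (by fun_prop), ← huniv, ← lintegral_one]
    refine lintegral_congr fun ω => ?_
    rw [← ENNReal.ofReal_add _ (Real.exp_pos _).le]
    · simp
    · have : Real.exp (-σ ω) ≤ 1 := Real.exp_le_one_iff.2 (by linarith [hpos ω])
      linarith
  rw [hlc] at hsum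
  have h2 : ENNReal.ofReal c = ENNReal.ofReal (c * (1 / (1 + a))) + ENNReal.ofReal (c * (a / (1 + a))) := by
    rw [← ENNReal.ofReal_add (by positivity) (by positivity)]
    congr 1; field_simp
  rw [h2] at hsum
  exact (ENNReal.add_right_inj ENNReal.ofReal_ne_top).1 hsum

variable (M : CTMC)

lemma P_nonneg (x y : M.X) : 0 ≤ M.P x y := by
  unfold CTMC.P
  split_ifs with h
  · exact le_rfl
  · exact div_nonneg (M.Γ_offdiag_nonneg x y h) (M.γ_pos x).le

lemma jump_meas_set (path : ℕ → M.X) (n : ℕ) :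
    MeasurableSet {ω | ∀ k, k ≤ n → M.jump k ω = path k} := by
  simp only [ofPred_forall]
  exact MeasurableSet.iInter fun k => MeasurableSet.iInter fun _ => M.jump_meas k _

lemma hold_meas_set (t : ℕ → ℝ) (p : ℕ → Prop) :
    MeasurableSet {ω | ∀ k, p k → t k < M.hold k ω} := by
  simp only [ofPred_forall]
  exact MeasurableSet.iInter fun k => MeasurableSet.iInter fun _ =>
    measurableSet_lt measurable_const (M.hold_meas k)

lemma mixed (x : M.X) (n : ℕ) (path : ℕ → M.X) (hp : path 0 = x) (j : ℕ) (hj : j ≤ n) :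
    ∀ t : ℕ → ℝ, (∀ k, 0 ≤ t k) →
    ∫⁻ ω in {ω | (∀ k, k ≤ n → M.jump k ω = path k) ∧ (∀ k, (j ≤ k ∧ k < n) → t k < M.hold k ω)},
      ENNReal.ofReal (Real.exp (- M.J j ω)) ∂(M.μ x)
    = ENNReal.ofReal (∏ k ∈ Finset.range n, (M.P (path k) (path (k+1)) *
        (if k < j then M.γ (path k) / (1 + M.γ (path k)) else Real.exp (-(M.γ (path k)) * t k)))) := by
  induction j with
  | zero =>
    intro t ht
    have := M.law x n path t hp ht
    simp only [CTMC.J, Finset.range_zero, Finset.sum_empty, neg_zero, Real.exp_zero,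
      ENNReal.ofReal_one, lintegral_one, Measure.restrict_apply_univ, zero_le, true_and,
      not_lt_zero, if_false]
    exact this
  | succ j ih =>
    intro t ht
    have hJm : ∀ i, Measurable (M.J i) := fun i => by
      unfold CTMC.J
      exact Finset.measurable_fun_sum _ fun k _ => M.hold_meas k
    set A := {ω | (∀ k, k ≤ n → M.jump k ω = path k) ∧
      (∀ k, (j + 1 ≤ k ∧ k < n) → t k < M.hold k ω)} with hA
    have hAm : MeasurableSet A := (jump_meas_set M path n).inter (hold_meas_set M t _)
    set D : M.Ω → ℝ≥0∞ := fun ω => ENNReal.ofReal (Real.exp (- M.J j ω)) with hD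
    have hDm : Measurable D := by
      have := hJm j
      fun_prop
    have hjn : j ∈ Finset.range n := Finset.mem_range.2 (by omega)
    set c : ℝ := (∏ k ∈ (Finset.range n).erase j, (M.P (path k) (path (k+1)) *
        (if k < j + 1 then M.γ (path k) / (1 + M.γ (path k))
          else Real.exp (-(M.γ (path k)) * t k)))) * M.P (path j) (path (j+1)) with hc
    have hγ := M.γ_pos
    have hc0 : 0 ≤ c := by
      refine mul_nonneg (Finset.prod_nonneg fun k _ => mul_nonneg (P_nonneg M _ _) ?_)
        (P_nonneg M _ _)
      have := hγ (path k)
      split_ifs <;> positivity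
    have key := one_step (((M.μ x).restrict A).withDensity D) (M.hold j) (M.hold_meas j)
      (M.hold_pos j) c (M.γ (path j)) hc0 (hγ _) (by
        intro s hs
        have hBm : MeasurableSet {ω | s < M.hold j ω} :=
          measurableSet_lt measurable_const (M.hold_meas j)
        rw [withDensity_apply _ hBm, Measure.restrict_restrict hBm]
        have := ih (by omega) (Function.update t j s) (by
          intro k
          by_cases hk : k = j
          · subst hk; simpa
          · simpa [hk] using ht k)
        have hset : {ω | s < M.hold j ω} ∩ A = {ω | (∀ k, k ≤ n → M.jump k ω = path k) ∧
            (∀ k, (j ≤ k ∧ k < n) → Function.update t j s k < M.hold k ω)} := by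
          ext ω
          simp only [hA, mem_inter_iff, mem_ofPred_eq]
          constructor
          · rintro ⟨h1, h2, h3⟩
            refine ⟨h2, fun k hk => ?_⟩
            by_cases hkj : k = j
            · subst hkj; simpa
            · simpa [hkj] using h3 k (by omega)
          · rintro ⟨h2, h3⟩
            refine ⟨by simpa using h3 j (by omega), h2, fun k hk => ?_⟩
            have hkj : k ≠ j := by omega
            simpa [hkj] using h3 k (by omega)
        rw [hset, this, ← Finset.mul_prod_erase _ _ hjn]
        congr 1
        simp only [hc, lt_irrefl, if_false, Function.update_self]
        rw [mul_comm, ← mul_assoc]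
        congr 2
        refine Finset.prod_congr rfl fun k hk => ?_
        have hkj : k ≠ j := Finset.ne_of_mem_erase hk
        congr 1
        by_cases h : k < j
        · simp [h, Nat.lt_succ_of_lt h]
        · have : ¬ k < j + 1 := by omega
          simp [h, this, hkj])
    have hint : ∫⁻ ω in A, ENNReal.ofReal (Real.exp (- M.J (j+1) ω)) ∂(M.μ x)
        = ∫⁻ ω, ENNReal.ofReal (Real.exp (-M.hold j ω)) ∂(((M.μ x).restrict A).withDensity D) := by
      have hm := M.hold_meas j
      rw [lintegral_withDensity_eq_lintegral_mul _ hDm (by fun_prop)]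
      refine lintegral_congr fun ω => ?_
      simp only [hD, Pi.mul_apply]
      rw [← ENNReal.ofReal_mul (Real.exp_pos _).le, ← Real.exp_add]
      congr 2
      simp only [CTMC.J, Finset.sum_range_succ]
      ring
    rw [hint, key, ← Finset.mul_prod_erase _ _ hjn]
    congr 1
    simp only [hc, Nat.lt_succ_self, if_true]
    ring

lemma J_meas (i : ℕ) : Measurable (M.J i) := by
  unfold CTMC.J
  exact Finset.measurable_fun_sum _ fun k _ => M.hold_meas k

/-- one-step kernel discounted -/
noncomputable def q (z y : M.X) : ℝ := M.P z y * (M.γ z / (1 + M.γ z))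

lemma q_nonneg (z y : M.X) : 0 ≤ q M z y := by
  have := M.γ_pos z
  exact mul_nonneg (P_nonneg M _ _) (by positivity)

lemma path_law (x : M.X) (n : ℕ) (path : ℕ → M.X) (hp : path 0 = x) :
    ∫⁻ ω in {ω | ∀ k, k ≤ n → M.jump k ω = path k},
      ENNReal.ofReal (Real.exp (- M.J n ω)) ∂(M.μ x)
    = ENNReal.ofReal (∏ k ∈ Finset.range n, q M (path k) (path (k+1))) := by
  have := mixed M x n path hp n le_rfl (fun _ => 0) (fun _ => le_rfl)
  have hs : {ω | (∀ k, k ≤ n → M.jump k ω = path k) ∧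
      (∀ k, (n ≤ k ∧ k < n) → (0:ℝ) < M.hold k ω)} = {ω | ∀ k, k ≤ n → M.jump k ω = path k} := by
    ext ω
    simp only [mem_ofPred_eq, and_iff_left_iff_imp]
    intro _ k hk; omega
  rw [hs] at this
  rw [this]
  congr 1
  refine Finset.prod_congr rfl fun k hk => ?_
  simp [q, Finset.mem_range.1 hk]

lemma path_step (x : M.X) (n : ℕ) (path : ℕ → M.X) :
    ∫⁻ ω in {ω | ∀ k, k ≤ n + 1 → M.jump k ω = path k},
      ENNReal.ofReal (Real.exp (- M.J (n + 1) ω)) ∂(M.μ x)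
    = ENNReal.ofReal (q M (path n) (path (n+1))) *
      ∫⁻ ω in {ω | ∀ k, k ≤ n → M.jump k ω = path k},
      ENNReal.ofReal (Real.exp (- M.J n ω)) ∂(M.μ x) := by
  by_cases hp : path 0 = x
  · rw [path_law M x _ path hp, path_law M x _ path hp, ← ENNReal.ofReal_mul (q_nonneg M _ _),
      Finset.prod_range_succ, mul_comm]
  · have h0 : ∀ m, M.μ x {ω | ∀ k, k ≤ m → M.jump k ω = path k} = 0 := by
      intro m
      have h1 : M.μ x {ω | M.jump 0 ω = x}ᶜ = 0 :=
        (prob_compl_eq_zero_iff (M.jump_meas 0 x)).2 (M.start x)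
      refine measure_mono_null ?_ h1
      intro ω hω
      simp only [mem_compl_iff, mem_ofPred_eq] at *
      rw [hω 0 (Nat.zero_le _)]
      exact hp
    rw [setLIntegral_measure_zero _ _ (h0 _), setLIntegral_measure_zero _ _ (h0 _), mul_zero]

lemma lintegral_fibers {Ω ι : Type} [MeasurableSpace Ω] [Countable ι] (μ : Measure Ω)
    (K : Ω → ι) (hK : ∀ i, MeasurableSet {ω | K ω = i}) (h : Ω → ℝ≥0∞) :
    ∫⁻ ω, h ω ∂μ = ∑' i, ∫⁻ ω in {ω | K ω = i}, h ω ∂μ := by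
  rw [← lintegral_iUnion hK]
  · have : (⋃ i, {ω | K ω = i}) = univ := by ext; simp
    rw [this, Measure.restrict_univ]
  · intro i j hij
    rw [Function.onFun, Set.disjoint_left]
    rintro ω h1 h2
    exact hij (h1.symm.trans h2)

/-- discounted expectation -/
noncomputable def E (x : M.X) (n : ℕ) (φ : M.X → ℝ≥0∞) : ℝ≥0∞ :=
  ∫⁻ ω, ENNReal.ofReal (Real.exp (- M.J n ω)) * φ (M.jump n ω) ∂(M.μ x)

lemma comp_meas (φ : M.X → ℝ≥0∞) (n : ℕ) : Measurable fun ω => φ (M.jump n ω) := by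
  let _ : MeasurableSpace M.X := ⊤
  have h1 : Measurable (M.jump n) := measurable_to_countable' fun x => M.jump_meas n x
  exact (measurable_from_top (f := φ)).comp h1

lemma E_integrand_meas (φ : M.X → ℝ≥0∞) (n : ℕ) :
    Measurable fun ω => ENNReal.ofReal (Real.exp (- M.J n ω)) * φ (M.jump n ω) := by
  have h1 := comp_meas M φ n
  have h2 := J_meas M n
  have h3 : Measurable fun ω => ENNReal.ofReal (Real.exp (- M.J n ω)) := by fun_prop
  exact h3.mul h1

lemma E_succ (x : M.X) (n : ℕ) (φ : M.X → ℝ≥0∞) :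
    E M x (n + 1) φ = E M x n (fun z => ∑' y, ENNReal.ofReal (q M z y) * φ y) := by
  let K : M.Ω → (Fin (n + 1) → M.X) := fun ω k => M.jump k ω
  have hK : ∀ p, MeasurableSet {ω | K ω = p} := by
    intro p
    simp only [K, funext_iff, ofPred_forall]
    exact MeasurableSet.iInter fun k => M.jump_meas _ _
  unfold E
  rw [lintegral_fibers (M.μ x) K hK, lintegral_fibers (M.μ x) K hK]
  congr 1; ext p
  rw [lintegral_fibers _ (M.jump (n + 1)) (M.jump_meas (n + 1))]
  have hR : ∫⁻ ω in {ω | K ω = p}, ENNReal.ofReal (Real.exp (- M.J n ω)) *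
      (∑' y, ENNReal.ofReal (q M (M.jump n ω) y) * φ y) ∂(M.μ x)
      = (∫⁻ ω in {ω | K ω = p}, ENNReal.ofReal (Real.exp (- M.J n ω)) ∂(M.μ x)) *
      (∑' y, ENNReal.ofReal (q M (p (Fin.last n)) y) * φ y) := by
    rw [← lintegral_mul_const _ (by have := J_meas M n; fun_prop)]
    refine setLIntegral_congr_fun (hK p) fun ω hω => ?_
    have : M.jump n ω = p (Fin.last n) := by
      rw [← (show K ω = p from hω)]; simp [K]
    simp only [this]
  rw [hR, ← ENNReal.tsum_mul_left]
  congr 1; ext y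
  let path : ℕ → M.X := fun k => if h : k < n + 1 then p ⟨k, h⟩ else y
  have hs1 : {ω | ∀ k, k ≤ n → M.jump k ω = path k} = {ω | K ω = p} := by
    ext ω
    simp only [mem_ofPred_eq, K, funext_iff, path]
    constructor
    · intro h k
      have := h k (by omega)
      simpa [k.2] using this
    · intro h k hk
      have hk' : k < n + 1 := by omega
      simpa [hk'] using h ⟨k, hk'⟩
  have hs2 : {ω | ∀ k, k ≤ n + 1 → M.jump k ω = path k}
      = {ω | M.jump (n + 1) ω = y} ∩ {ω | K ω = p} := by
    rw [← hs1]
    ext ω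
    simp only [mem_ofPred_eq, mem_inter_iff]
    constructor
    · intro h
      exact ⟨by simpa [path] using h (n + 1) le_rfl, fun k hk => h k (by omega)⟩
    · rintro ⟨h1, h2⟩ k hk
      rcases Nat.lt_or_ge k (n + 1) with h | h
      · exact h2 k (by omega)
      · obtain rfl : k = n + 1 := by omega
        simpa [path] using h1
  have hps := path_step M x n path
  rw [hs1, hs2] at hps
  have e1 : path n = p (Fin.last n) := by simp [path, Fin.last]
  have e2 : path (n + 1) = y := by simp [path]
  rw [e1, e2] at hps
  rw [Measure.restrict_restrict (M.jump_meas _ _)]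
  have hL : ∫⁻ ω in {ω | M.jump (n + 1) ω = y} ∩ {ω | K ω = p},
      ENNReal.ofReal (Real.exp (- M.J (n + 1) ω)) * φ (M.jump (n + 1) ω) ∂(M.μ x)
      = (∫⁻ ω in {ω | M.jump (n + 1) ω = y} ∩ {ω | K ω = p},
        ENNReal.ofReal (Real.exp (- M.J (n + 1) ω)) ∂(M.μ x)) * φ y := by
    rw [← lintegral_mul_const _ (by have := J_meas M (n + 1); fun_prop)]
    refine setLIntegral_congr_fun ((M.jump_meas _ _).inter (hK p)) fun ω hω => ?_
    simp only [show M.jump (n + 1) ω = y from hω.1]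
  rw [hL, hps]
  ring

end CTMCProof

namespace CTMCProof

/-- Osgood-type change of the Lyapunov function. -/
lemma exists_G (g : ℝ → ℝ) (hgmono : MonotoneOn g (Set.Ici 0))
    (hloc : ∀ z : ℝ, 0 ≤ z → ∫⁻ y in Set.Ioc (0:ℝ) z, (ENNReal.ofReal (g y))⁻¹ < ⊤)
    (htail : Filter.Tendsto (fun z : ℝ => ∫⁻ y in Set.Ioc (0:ℝ) z, (ENNReal.ofReal (g y))⁻¹)
      Filter.atTop (nhds ⊤)) :
    ∃ G h : ℝ → ℝ, (∀ z, 0 ≤ z → 0 ≤ G z ∧ G z ≤ z ∧ 0 ≤ h z ∧ h z * g z ≤ 1) ∧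
      (∀ a b, 0 ≤ a → 0 ≤ b → G b ≤ G a + h a * (b - a)) ∧ MonotoneOn G (Set.Ici 0) ∧
      (∀ r, ∃ z, 0 ≤ z ∧ r < G z) := by
  let h : ℝ → ℝ := fun y => (max (g y) 1)⁻¹
  have hm : ∀ y, 1 ≤ max (g y) 1 := fun y => le_max_right _ _
  have h0 : ∀ y, 0 ≤ h y := fun y => inv_nonneg.2 (by linarith [hm y])
  have h1 : ∀ y, h y ≤ 1 := fun y => inv_le_one_of_one_le₀ (hm y)
  have hanti : AntitoneOn h (Set.Ici 0) := by
    intro a ha b hb hab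
    exact inv_anti₀ (by linarith [hm a]) (max_le_max_right _ (hgmono ha hb hab))
  have hint : ∀ a b, 0 ≤ a → 0 ≤ b → IntervalIntegrable h volume a b := by
    intro a b ha hb
    refine AntitoneOn.intervalIntegrable (hanti.mono ?_)
    intro y hy
    exact le_trans (le_min ha hb) hy.1
  let G : ℝ → ℝ := fun z => ∫ y in (0:ℝ)..z, h y
  have hsub : ∀ a b, 0 ≤ a → 0 ≤ b → G b - G a = ∫ y in a..b, h y := fun a b ha hb =>
    intervalIntegral.integral_interval_sub_left (hint 0 b le_rfl hb) (hint 0 a le_rfl ha)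
  have hGmono : MonotoneOn G (Set.Ici 0) := by
    intro a ha b hb hab
    have := hsub a b ha hb
    have := intervalIntegral.integral_nonneg (μ := volume) hab fun y _ => h0 y
    linarith
  have hG0 : G 0 = 0 := by simp [G]
  have htan : ∀ a b, 0 ≤ a → 0 ≤ b → G b ≤ G a + h a * (b - a) := by
    intro a b ha hb
    have hs := hsub a b ha hb
    rcases le_total a b with hab | hab
    · have := intervalIntegral.integral_mono_on (μ := volume) hab (hint a b ha hb)
        (intervalIntegrable_const (c := h a)) (fun y hy => hanti ha (ha.trans hy.1) hy.1)
      rw [intervalIntegral.integral_const, smul_eq_mul] at this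
      linarith
    · have := intervalIntegral.integral_mono_on (μ := volume) hab
        (intervalIntegrable_const (c := h a)) (hint b a hb ha)
        (fun y hy => hanti (hb.trans hy.1) ha hy.2)
      rw [intervalIntegral.integral_const, smul_eq_mul, ] at this
      rw [intervalIntegral.integral_symm] at hs
      linarith
  refine ⟨G, h, fun z hz => ⟨?_, ?_, h0 z, ?_⟩, htan, hGmono, ?_⟩
  · rw [← hG0]; exact hGmono (mem_Ici.2 le_rfl) hz hz
  · have := htan 0 z le_rfl hz
    have := h1 0
    nlinarith
  · have := hm z
    calc h z * g z ≤ h z * max (g z) 1 := mul_le_mul_of_nonneg_left (le_max_left _ _) (h0 z)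
      _ = 1 := inv_mul_cancel₀ (by linarith)
  · intro r
    by_cases hz : ∃ z0, 0 ≤ z0 ∧ 1 ≤ g z0
    · obtain ⟨z0, hz0, hg1⟩ := hz
      have hC := hloc z0 hz0
      set C := ∫⁻ y in Set.Ioc (0:ℝ) z0, (ENNReal.ofReal (g y))⁻¹ with hCdef
      have hlt : C + ENNReal.ofReal r < ⊤ := ENNReal.add_lt_top.2 ⟨hC, ENNReal.ofReal_lt_top⟩
      obtain ⟨z, hzr, hzz⟩ := ((htail.eventually (lt_mem_nhds hlt)).and
        (eventually_ge_atTop z0)).exists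
      have hz0' : 0 ≤ z := hz0.trans hzz
      refine ⟨z, hz0', ?_⟩
      have hle : ∫⁻ y in Set.Ioc (0:ℝ) z, (ENNReal.ofReal (g y))⁻¹ ≤ C + ENNReal.ofReal (G z) := by
        rw [← Ioc_union_Ioc_eq_Ioc hz0 hzz]
        refine (lintegral_union_le _ _ _).trans (add_le_add le_rfl ?_)
        have e : ∫⁻ y in Set.Ioc z0 z, (ENNReal.ofReal (g y))⁻¹
            = ∫⁻ y in Set.Ioc z0 z, ENNReal.ofReal (h y) := by
          refine setLIntegral_congr_fun measurableSet_Ioc fun y hy => ?_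
          have : 1 ≤ g y := hg1.trans (hgmono hz0 (hz0.trans hy.1.le) hy.1.le)
          simp only [h, max_eq_left this]
          rw [ENNReal.ofReal_inv_of_pos (by linarith)]
        rw [e, ← ofReal_integral_eq_lintegral_ofReal
          ((intervalIntegrable_iff_integrableOn_Ioc_of_le hzz).1 (hint z0 z hz0 hz0'))
          (Eventually.of_forall fun y => h0 y), ← intervalIntegral.integral_of_le hzz,
          ← hsub z0 z hz0 hz0']
        apply ENNReal.ofReal_le_ofReal
        have : G 0 ≤ G z0 := hGmono (mem_Ici.2 le_rfl) hz0 hz0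
        linarith
      have := lt_of_lt_of_le hzr hle
      have h3 := lt_of_add_lt_add_left this
      exact (ENNReal.ofReal_lt_ofReal_iff'.1 h3).1
    · push Not at hz
      refine ⟨max r 0 + 1, by positivity, ?_⟩
      have hb : (0:ℝ) ≤ max r 0 + 1 := by positivity
      have : G (max r 0 + 1) = ∫ y in (0:ℝ)..(max r 0 + 1), (1:ℝ) := by
        refine intervalIntegral.integral_congr fun y hy => ?_
        rw [uIcc_of_le hb] at hy
        simp [h, max_eq_right (hz y hy.1).le]
      rw [this]
      simp
      linarith [le_max_left r 0]

variable (M : CTMC)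

lemma reduce (f : M.X → ℝ) (hf : M.InDomPos f) (hfinf : M.FinSublevels f)
    (g : ℝ → ℝ) (hgmono : MonotoneOn g (Set.Ici 0))
    (hloc : ∀ z : ℝ, 0 ≤ z → ∫⁻ y in Set.Ioc (0:ℝ) z, (ENNReal.ofReal (g y))⁻¹ < ⊤)
    (htail : Filter.Tendsto (fun z : ℝ => ∫⁻ y in Set.Ioc (0:ℝ) z, (ENNReal.ofReal (g y))⁻¹)
      Filter.atTop (nhds ⊤))
    (hdrift : ∀ x : M.X, M.gen f x ≤ g (f x)) :
    ∃ F : M.X → ℝ, M.InDomPos F ∧ M.FinSublevels F ∧ ∀ x, M.gen F x ≤ 1 := by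
  obtain ⟨G, h, hGh, htan, hGmono, hGinf⟩ := exists_G g hgmono hloc htail
  obtain ⟨hf0, hfs⟩ := hf
  have hFs : M.InDom (fun x => G (f x)) := by
    intro x
    refine Summable.of_nonneg_of_le (fun y => ?_) (fun y => ?_) (hfs x)
    · split_ifs with hy
      · exact le_rfl
      · exact mul_nonneg (M.Γ_offdiag_nonneg _ _ hy) (hGh _ (hf0 y)).1
    · split_ifs with hy
      · exact le_rfl
      · exact mul_le_mul_of_nonneg_left (hGh _ (hf0 y)).2.1 (M.Γ_offdiag_nonneg _ _ hy)
  refine ⟨fun x => G (f x), ⟨fun x => (hGh _ (hf0 x)).1, hFs⟩, ?_, ?_⟩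
  · intro r
    obtain ⟨z, hz, hr⟩ := hGinf r
    refine (hfinf z).subset fun x hx => ?_
    simp only [mem_ofPred_eq] at *
    by_contra hlt
    have := hGmono hz (hf0 x) (not_le.1 hlt).le
    linarith
  · intro x
    have hsum : HasSum (fun y => (G (f x) - h (f x) * f x) * (if y = x then 0 else M.Γ x y)
        + h (f x) * (if y = x then 0 else M.Γ x y * f y))
        ((G (f x) - h (f x) * f x) * M.γ x + h (f x) * ∑' y, if y = x then 0 else M.Γ x y * f y) :=
      ((M.γ_sum x).mul_left _).add ((hfs x).hasSum.mul_left _)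
    have hle := hasSum_le (fun y => by
      split_ifs with hy
      · simp
      · have h1 := mul_le_mul_of_nonneg_left (htan (f x) (f y) (hf0 x) (hf0 y))
          (M.Γ_offdiag_nonneg x y hy)
        linarith) (hFs x).hasSum hsum
    have h2 := hGh _ (hf0 x)
    have h3 := mul_le_mul_of_nonneg_left (hdrift x) h2.2.2.1
    unfold CTMC.gen at *
    simp only at *
    linarith [h2.2.2.2]

end CTMCProof

namespace CTMCProof

variable (M : CTMC)

lemma q_eq (z y : M.X) : q M z y = (if y = z then 0 else M.Γ z y) / (1 + M.γ z) := by
  have := M.γ_pos z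
  unfold q CTMC.P
  split_ifs
  · simp
  · field_simp

lemma E_zero (x : M.X) (φ : M.X → ℝ≥0∞) : E M x 0 φ = φ x := by
  have h1 : ∀ᵐ ω ∂(M.μ x), M.jump 0 ω = x :=
    (prob_compl_eq_zero_iff (M.jump_meas 0 x)).2 (M.start x)
  have : E M x 0 φ = ∫⁻ _, φ x ∂(M.μ x) := by
    unfold E
    refine lintegral_congr_ae ?_
    filter_upwards [h1] with ω hω
    simp [CTMC.J, hω]
  rw [this]; simp

lemma E_mono (x : M.X) (n : ℕ) {φ ψ : M.X → ℝ≥0∞} (h : ∀ y, φ y ≤ ψ y) :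
    E M x n φ ≤ E M x n ψ :=
  lintegral_mono fun _ => mul_le_mul_right (h _) _

lemma E_add (x : M.X) (n : ℕ) (φ ψ : M.X → ℝ≥0∞) :
    E M x n (fun y => φ y + ψ y) = E M x n φ + E M x n ψ := by
  unfold E
  rw [← lintegral_add_left (E_integrand_meas M φ n)]
  simp only [mul_add]

/-- killing weight -/
noncomputable def r (y : M.X) : ℝ≥0∞ := ENNReal.ofReal (1 / (1 + M.γ y))

lemma Q_one (z : M.X) : (∑' y, ENNReal.ofReal (q M z y) * 1) + r M z = 1 := by
  have hg := M.γ_pos z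
  have hs : HasSum (q M z) (M.γ z / (1 + M.γ z)) := by
    have := (M.γ_sum z).div_const (1 + M.γ z)
    simpa only [← q_eq] using this
  simp only [mul_one]
  rw [← ENNReal.ofReal_tsum_of_nonneg (q_nonneg M z) hs.summable, hs.tsum_eq, r,
    ← ENNReal.ofReal_add (by positivity) (by positivity), ← ENNReal.ofReal_one]
  congr 1; field_simp; ring

lemma E_telescope (x : M.X) (n : ℕ) :
    (∑ k ∈ Finset.range n, E M x k (r M)) + E M x n (fun _ => 1) = 1 := by
  induction n with
  | zero => simp [E_zero]
  | succ n ih =>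
    rw [Finset.sum_range_succ, E_succ, add_assoc, ← E_add]
    have : (fun y => r M y + ∑' y_1, ENNReal.ofReal (q M y y_1) * 1) = fun _ => 1 := by
      ext y; rw [add_comm, Q_one]
    rw [this, ih]

lemma Q_u (F : M.X → ℝ) (hF : M.InDomPos F) (hd : ∀ x, M.gen F x ≤ 1) (z : M.X) :
    (∑' y, ENNReal.ofReal (q M z y) * ENNReal.ofReal (F y + 1)) ≤ ENNReal.ofReal (F z + 1) := by
  have hg := M.γ_pos z
  have hs : HasSum (fun y => q M z y * (F y + 1))
      (((∑' y, if y = z then 0 else M.Γ z y * F y) + M.γ z) / (1 + M.γ z)) := by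
    have := (((hF.2 z).hasSum).add (M.γ_sum z)).div_const (1 + M.γ z)
    refine this.congr_fun ?_ |> id
    intro y
    rw [q_eq]
    split_ifs <;> ring
  have h0 : ∀ y, 0 ≤ q M z y * (F y + 1) := fun y =>
    mul_nonneg (q_nonneg M z y) (by linarith [hF.1 y])
  simp only [← ENNReal.ofReal_mul (q_nonneg M z _)]
  rw [← ENNReal.ofReal_tsum_of_nonneg h0 hs.summable, hs.tsum_eq]
  apply ENNReal.ofReal_le_ofReal
  rw [div_le_iff₀ (by linarith)]
  have := hd z
  unfold CTMC.gen at this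
  have := hF.1 z
  nlinarith

lemma E_u (F : M.X → ℝ) (hF : M.InDomPos F) (hd : ∀ x, M.gen F x ≤ 1) (x : M.X) (n : ℕ) :
    E M x n (fun y => ENNReal.ofReal (F y + 1)) ≤ ENNReal.ofReal (F x + 1) := by
  induction n with
  | zero => rw [E_zero]
  | succ n ih =>
    rw [E_succ]
    exact (E_mono M x n (Q_u M F hF hd)).trans ih

lemma pathwise (F : M.X → ℝ) (hfin : M.FinSublevels F) (ω : M.Ω)
    (h1 : ∑' n, ENNReal.ofReal (Real.exp (- M.J n ω)) * r M (M.jump n ω) ≠ ⊤)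
    (h2 : liminf (fun n => ENNReal.ofReal (Real.exp (- M.J n ω)) *
      ENNReal.ofReal (F (M.jump n ω) + 1)) atTop ≠ ⊤) : M.zeta ω = ⊤ := by
  by_contra hz
  set Z := (M.zeta ω).toReal with hZ
  have hJ : ∀ n, M.J n ω ≤ Z := fun n => by
    rw [hZ, ← ENNReal.ofReal_le_iff_le_toReal hz]
    exact le_iSup (fun n => ENNReal.ofReal (M.J n ω)) n
  have hexp : ∀ n, Real.exp (-Z) ≤ Real.exp (- M.J n ω) := fun n =>
    Real.exp_le_exp.2 (by linarith [hJ n])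
  have hc : 0 < Real.exp (-Z) := Real.exp_pos _
  have ht := ENNReal.tendsto_atTop_zero_of_tsum_ne_top h1
  have hev : ∀ K : ℝ, ∀ᶠ n in atTop, K < F (M.jump n ω) := by
    intro K
    have hall : ∀ᶠ n in atTop, ∀ y ∈ {y | F y ≤ K}, M.jump n ω ≠ y := by
      rw [(hfin K).eventually_all]
      intro y _
      have hp : 0 < ENNReal.ofReal (Real.exp (-Z)) * r M y := by
        have := M.γ_pos y
        refine ENNReal.mul_pos ?_ ?_
        · simpa using hc
        · simp only [r, ne_eq, ENNReal.ofReal_eq_zero, not_le]; positivity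
      filter_upwards [ht.eventually (gt_mem_nhds hp)] with n hn heq
      rw [heq] at hn
      exact absurd hn (not_lt.2 (mul_le_mul_left (ENNReal.ofReal_le_ofReal (hexp n)) _))
    filter_upwards [hall] with n hn
    by_contra hle
    exact hn _ (not_lt.1 hle) rfl
  apply h2
  refine ENNReal.eq_top_of_forall_nnreal_le fun L => ?_
  refine le_liminf_of_le (by isBoundedDefault) ?_
  filter_upwards [hev (L / Real.exp (-Z))] with n hn
  rw [← ENNReal.ofReal_mul (Real.exp_pos _).le, ← ENNReal.ofReal_coe_nnreal]
  apply ENNReal.ofReal_le_ofReal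
  have hL : (0:ℝ) ≤ L / Real.exp (-Z) := by positivity
  rw [div_lt_iff₀ hc] at hn
  have := mul_le_mul_of_nonneg_right (hexp n)
    (show 0 ≤ F (M.jump n ω) + 1 by
      rw [← div_lt_iff₀ hc] at hn; linarith)
  nlinarith

lemma main (F : M.X → ℝ) (hF : M.InDomPos F) (hfin : M.FinSublevels F)
    (hd : ∀ x, M.gen F x ≤ 1) (x : M.X) : ∀ᵐ ω ∂(M.μ x), M.zeta ω = ⊤ := by
  have h1 : ∀ᵐ ω ∂(M.μ x),
      ∑' n, ENNReal.ofReal (Real.exp (- M.J n ω)) * r M (M.jump n ω) < ⊤ := by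
    refine ae_lt_top (Measurable.ennreal_tsum fun n => E_integrand_meas M (r M) n) ?_
    rw [lintegral_tsum fun n => (E_integrand_meas M (r M) n).aemeasurable]
    refine ne_top_of_le_ne_top ENNReal.one_ne_top ?_
    refine ENNReal.tsum_le_of_sum_range_le fun n => ?_
    exact le_self_add.trans (E_telescope M x n).le
  have h2 : ∀ᵐ ω ∂(M.μ x), liminf (fun n => ENNReal.ofReal (Real.exp (- M.J n ω)) *
      ENNReal.ofReal (F (M.jump n ω) + 1)) atTop < ⊤ := by
    have hm := fun n => E_integrand_meas M (fun y => ENNReal.ofReal (F y + 1)) n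
    refine ae_lt_top (Measurable.liminf hm) ?_
    refine ne_top_of_le_ne_top (ENNReal.ofReal_ne_top (r := F x + 1)) ?_
    refine (lintegral_liminf_le hm).trans ?_
    refine liminf_le_of_le (by isBoundedDefault) fun b hb => ?_
    obtain ⟨n, hn⟩ := hb.exists
    exact hn.trans (E_u M F hF hd x n)
  filter_upwards [h1, h2] with ω a b
  exact pathwise M F hfin ω a.ne b.ne

end CTMCProof

open CTMC in
/-- Theorem (non-explosion): if `f ∈ Dom_+(Γ)` tends to infinity and
`Γ f(x) ≤ g(f(x))` for an increasing `g : [0,∞) → [0,∞)` whose reciprocal is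
locally integrable with non-integrable tail (`G(z) = ∫_0^z dy/g(y) < ∞` for
all `z ≥ 0` and `G(z) → ∞`), then the chain is conservative:
`P_x(ζ = ∞) = 1` for all `x`. -/
theorem statement6 (M : CTMC) (f : M.X → ℝ) (hf : M.InDomPos f) (hfinf : M.FinSublevels f)
    (g : ℝ → ℝ) (hgnn : ∀ y : ℝ, 0 ≤ y → 0 ≤ g y) (hgmono : MonotoneOn g (Set.Ici 0))
    (hloc : ∀ z : ℝ, 0 ≤ z → ∫⁻ y in Set.Ioc (0:ℝ) z, (ENNReal.ofReal (g y))⁻¹ < ⊤)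
    (htail : Filter.Tendsto (fun z : ℝ => ∫⁻ y in Set.Ioc (0:ℝ) z, (ENNReal.ofReal (g y))⁻¹)
      Filter.atTop (nhds ⊤))
    (hdrift : ∀ x : M.X, M.gen f x ≤ g (f x)) :
    ∀ x : M.X, M.μ x {ω | M.zeta ω = ⊤} = 1 := by
  intro x
  obtain ⟨F, h1, h2, h3⟩ := CTMCProof.reduce M f hf hfinf g hgmono hloc htail hdrift
  have h := CTMCProof.main M F h1 h2 h3 x
  have he : ({ω | M.zeta ω = ⊤} : Set M.Ω) =ᵐ[M.μ x] Set.univ := eventuallyEq_univ.2 h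
  rw [measure_congr he, measure_univ]
end

section
/- Suppose the embedded jump chain is recurrent. The following are equivalent: (1) there exist a function f ∈ Dom_+(Γ) with b := sup_{x∈𝕏} f(x) < ∞, a number a ∈ (0,b) such that the sublevel set {f ≤ a} is finite, and a constant ε > 0 such that Γf(x) ≤ −ε for all x ∉ {f ≤ a}; (2) for every finite nonempty A ⊆ 𝕏 there exists a constant C > 0 such that E_x(τ_A) ≤ C for all x ∉ A (i.e. the chain implodes towards every finite set). -/
open MeasureTheory Set Filter
open scoped Classical ENNReal NNReal

namespace CTMC

/-- transition probabilities, extended nonnegative -/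
noncomputable def Pe (M : CTMC) (x y : M.X) : ℝ≥0∞ :=
  ENNReal.ofReal (if y = x then 0 else M.Γ x y / M.γ x)

/-- action of the transition kernel -/
noncomputable def PP (M : CTMC) (g : M.X → ℝ≥0∞) (x : M.X) : ℝ≥0∞ := ∑' y, M.Pe x y * g y

/-- iterates of the kernel killed on `A` -/
noncomputable def q (M : CTMC) (A : Set M.X) (r : M.X → ℝ≥0∞) : ℕ → M.X → ℝ≥0∞
  | 0 => fun x => if x ∈ A then 0 else r x
  | m+1 => fun x => if x ∈ A then 0 else M.PP (q M A r m) x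

/-- cylinder event -/
def cyl (M : CTMC) (A : Set M.X) (p : ℕ → M.X) (n m : ℕ) : Set M.Ω :=
  {ω | (∀ k, k ≤ n → M.jump k ω = p k) ∧ ∀ k, n ≤ k → k ≤ n + m → M.jump k ω ∉ A}

/-- weight of a path -/
noncomputable def wt (M : CTMC) (p : ℕ → M.X) (n : ℕ) : ℝ≥0∞ :=
  ∏ k ∈ Finset.range n, M.Pe (p k) (p (k+1))

lemma tr_nonneg (M : CTMC) (x y : M.X) : 0 ≤ (if y = x then 0 else M.Γ x y / M.γ x) := by
  split_ifs with h
  · exact le_rfl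
  · exact div_nonneg (M.Γ_offdiag_nonneg x y h) (M.γ_pos x).le

lemma tr_hasSum (M : CTMC) (x : M.X) :
    HasSum (fun y => if y = x then 0 else M.Γ x y / M.γ x) 1 := by
  have := (M.γ_sum x).div_const (M.γ x)
  rw [div_self (M.γ_pos x).ne'] at this
  have he : (fun y => if y = x then 0 else M.Γ x y / M.γ x) =
      fun i => (if i = x then 0 else M.Γ x i) / M.γ x := by
    ext y
    split_ifs <;> simp
  rw [he]; exact this

lemma Pe_sum (M : CTMC) (x : M.X) : ∑' y, M.Pe x y = 1 := by
  unfold Pe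
  rw [← ENNReal.ofReal_tsum_of_nonneg (M.tr_nonneg x) (M.tr_hasSum x).summable,
    (M.tr_hasSum x).tsum_eq]
  simp

lemma PP_one (M : CTMC) (x : M.X) : M.PP (fun _ => 1) x = 1 := by
  simp [PP, Pe_sum]

lemma PP_mono (M : CTMC) {g h : M.X → ℝ≥0∞} (H : ∀ x, g x ≤ h x) (x : M.X) :
    M.PP g x ≤ M.PP h x :=
  ENNReal.tsum_le_tsum fun y => mul_le_mul_right (H y) _

lemma PP_add (M : CTMC) (g h : M.X → ℝ≥0∞) (x : M.X) :
    M.PP (fun y => g y + h y) x = M.PP g x + M.PP h x := by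
  simp [PP, mul_add, ENNReal.tsum_add]

lemma PP_smul (M : CTMC) (K : ℝ≥0∞) (h : M.X → ℝ≥0∞) (x : M.X) :
    M.PP (fun y => K * h y) x = K * M.PP h x := by
  simp only [PP, ← ENNReal.tsum_mul_left]
  congr 1; ext y; ring

lemma PP_sum (M : CTMC) (g : ℕ → M.X → ℝ≥0∞) (n : ℕ) (x : M.X) :
    M.PP (fun y => ∑ m ∈ Finset.range n, g m y) x = ∑ m ∈ Finset.range n, M.PP (g m) x := by
  induction n with
  | zero => simp [PP]
  | succ n ih =>
    simp only [Finset.sum_range_succ]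
    rw [PP_add, ih]

lemma PP_tsum (M : CTMC) (g : ℕ → M.X → ℝ≥0∞) (x : M.X) :
    M.PP (fun y => ∑' m, g m y) x = ∑' m, M.PP (g m) x := by
  simp only [PP, ← ENNReal.tsum_mul_left]
  exact ENNReal.tsum_comm

/-! ### measurability -/

lemma meas_mem (M : CTMC) (k : ℕ) (B : Set M.X) : MeasurableSet {ω | M.jump k ω ∈ B} := by
  have : {ω | M.jump k ω ∈ B} = ⋃ y ∈ B, {ω | M.jump k ω = y} := by
    ext ω; simp
  rw [this]
  exact MeasurableSet.biUnion (Set.to_countable B) fun y _ => M.jump_meas k y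

lemma meas_cyl (M : CTMC) (A : Set M.X) (p : ℕ → M.X) (n m : ℕ) :
    MeasurableSet (M.cyl A p n m) := by
  unfold cyl
  simp only [Set.ofPred_and, Set.ofPred_forall]
  refine MeasurableSet.inter ?_ ?_
  · exact MeasurableSet.iInter fun k => MeasurableSet.iInter fun _ => M.jump_meas k _
  · exact MeasurableSet.iInter fun k => MeasurableSet.iInter fun _ =>
      MeasurableSet.iInter fun _ => M.meas_mem k Aᶜ

lemma lint_split (M : CTMC) (x : M.X) (S : Set M.Ω) (hS : MeasurableSet S) (k : ℕ)
    (Z : M.Ω → ℝ≥0∞) :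
    ∫⁻ ω in S, Z ω ∂ M.μ x = ∑' y, ∫⁻ ω in S ∩ {ω | M.jump k ω = y}, Z ω ∂ M.μ x := by
  have : S = ⋃ y, S ∩ {ω | M.jump k ω = y} := by
    ext ω; simp
  conv_lhs => rw [this]
  refine lintegral_iUnion (fun y => hS.inter (M.jump_meas k y)) ?_ Z
  intro y z hyz
  refine Set.disjoint_left.2 ?_
  rintro ω ⟨_, h1⟩ ⟨_, h2⟩
  exact hyz (h1.symm.trans h2)

/-- the killed Markov property -/
lemma cyl_lint (M : CTMC) (x : M.X) (A : Set M.X) (r : M.X → ℝ≥0∞) (Z : ℕ → M.Ω → ℝ≥0∞)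
    (hZ : ∀ n (p : ℕ → M.X), p 0 = x →
      ∫⁻ ω in M.cyl ∅ p n 0, Z n ω ∂ M.μ x = M.wt p n * r (p n)) (m : ℕ) :
    ∀ n (p : ℕ → M.X), p 0 = x →
      ∫⁻ ω in M.cyl A p n m, Z (n + m) ω ∂ M.μ x = M.wt p n * M.q A r m (p n) := by
  induction m with
  | zero =>
    intro n p hp
    by_cases h : p n ∈ A
    · have : M.cyl A p n 0 = ∅ := by
        ext ω
        simp only [cyl, Set.mem_ofPred_eq, Set.mem_empty_iff_false, iff_false, not_and]
        intro h1 h2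
        exact h2 n le_rfl le_rfl (by rw [h1 n le_rfl]; exact h)
      simp [this, q, h]
    · have : M.cyl A p n 0 = M.cyl ∅ p n 0 := by
        ext ω
        simp only [cyl, Set.mem_ofPred_eq, Set.mem_empty_iff_false]
        refine and_congr_right fun h1 => ?_
        simp only [not_false_iff, implies_true, iff_true]
        intro k hk hk'
        obtain rfl : k = n := by omega
        rw [h1 k le_rfl]; exact h
      rw [this]
      simp only [add_zero, q, h, if_false]
      exact hZ n p hp
  | succ m ih =>
    intro n p hp
    by_cases h : p n ∈ A
    · have : M.cyl A p n (m+1) = ∅ := by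
        ext ω
        simp only [cyl, Set.mem_ofPred_eq, Set.mem_empty_iff_false, iff_false, not_and]
        intro h1 h2
        exact h2 n le_rfl (by omega) (by rw [h1 n le_rfl]; exact h)
      simp [this, q, h]
    · rw [M.lint_split x _ (M.meas_cyl A p n (m+1)) (n+1)]
      simp only [q, h, if_false, PP]
      rw [← ENNReal.tsum_mul_left]
      congr 1
      ext y
      let p' : ℕ → M.X := Function.update p (n+1) y
      have hp'k : ∀ k, k ≤ n → p' k = p k := fun k hk =>
        Function.update_of_ne (by omega) _ _
      have hp'n : p' (n+1) = y := Function.update_self _ _ _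
      have hset : M.cyl A p n (m+1) ∩ {ω | M.jump (n+1) ω = y} = M.cyl A p' (n+1) m := by
        ext ω
        simp only [cyl, Set.mem_inter_iff, Set.mem_ofPred_eq]
        constructor
        · rintro ⟨⟨h1, h2⟩, h3⟩
          refine ⟨fun k hk => ?_, fun k hk hk' => h2 k (by omega) (by omega)⟩
          rcases Nat.lt_or_ge n k with hkn | hkn
          · obtain rfl : k = n+1 := by omega
            rw [hp'n, h3]
          · rw [hp'k k hkn, h1 k hkn]
        · rintro ⟨h1, h2⟩
          refine ⟨⟨fun k hk => ?_, fun k hk hk' => ?_⟩, ?_⟩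
          · rw [h1 k (by omega), hp'k k hk]
          · rcases Nat.lt_or_ge n k with hkn | hkn
            · exact h2 k (by omega) (by omega)
            · obtain rfl : k = n := by omega
              rw [h1 k (by omega), hp'k k le_rfl]; exact h
          · rw [h1 (n+1) le_rfl, hp'n]
      have := ih (n+1) p' (by rw [hp'k 0 (Nat.zero_le _), hp])
      rw [hset, show n + (m+1) = n + 1 + m by omega, this, hp'n]
      have hw : M.wt p' (n+1) = M.wt p n * M.Pe (p n) y := by
        unfold wt
        rw [Finset.prod_range_succ, hp'n, hp'k n le_rfl]
        congr 1
        refine Finset.prod_congr rfl fun k hk => ?_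
        have := Finset.mem_range.1 hk
        rw [hp'k k (by omega), hp'k (k+1) (by omega)]
      rw [hw]; ring

lemma law_wt (M : CTMC) (x : M.X) (n : ℕ) (p : ℕ → M.X) (hp : p 0 = x) :
    M.μ x (M.cyl ∅ p n 0) = M.wt p n := by
  have := M.law x n p (fun _ => 0) hp (fun _ => le_rfl)
  have hs : M.cyl ∅ p n 0 =
      {ω | (∀ k, k ≤ n → M.jump k ω = p k) ∧ (∀ k, k < n → (0:ℝ) < M.hold k ω)} := by
    ext ω; simp [cyl, M.hold_pos]
  rw [hs, this]
  unfold wt Pe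
  rw [ENNReal.ofReal_prod_of_nonneg]
  · simp
  · intro k _
    exact mul_nonneg (M.tr_nonneg _ _) (Real.exp_pos _).le

lemma base_one (M : CTMC) (x : M.X) (n : ℕ) (p : ℕ → M.X) (hp : p 0 = x) :
    ∫⁻ _ in M.cyl ∅ p n 0, 1 ∂ M.μ x = M.wt p n * 1 := by
  simp [M.law_wt x n p hp]

lemma exp_lint (g : ℝ) (hg : 0 < g) :
    ∫⁻ t in Set.Ioi (0:ℝ), ENNReal.ofReal (Real.exp (-g * t)) = ENNReal.ofReal (1 / g) := by
  rw [← ofReal_integral_eq_lintegral_ofReal]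
  · have := integral_exp_mul_Ioi (a := -g) (by linarith) 0
    rw [this]; simp
  · exact integrableOn_exp_mul_Ioi (by linarith) 0
  · exact Filter.Eventually.of_forall fun t => (Real.exp_pos _).le

lemma base_hold (M : CTMC) (x : M.X) (n : ℕ) (p : ℕ → M.X) (hp : p 0 = x) :
    ∫⁻ ω in M.cyl ∅ p n 0, ENNReal.ofReal (M.hold n ω) ∂ M.μ x
      = M.wt p n * ENNReal.ofReal (1 / M.γ (p n)) := by
  rw [M.lint_split x _ (M.meas_cyl ∅ p n 0) (n+1)]
  have key : ∀ y, ∫⁻ ω in M.cyl ∅ p n 0 ∩ {ω | M.jump (n+1) ω = y},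
      ENNReal.ofReal (M.hold n ω) ∂ M.μ x =
      M.wt p n * ENNReal.ofReal (1 / M.γ (p n)) * M.Pe (p n) y := by
    intro y
    let p' : ℕ → M.X := Function.update p (n+1) y
    have hp'k : ∀ k, k ≤ n → p' k = p k := fun k hk =>
      Function.update_of_ne (by omega) _ _
    have hp'n : p' (n+1) = y := Function.update_self _ _ _
    rw [lintegral_eq_lintegral_meas_lt _ (Filter.Eventually.of_forall fun ω => (M.hold_pos n ω).le)
      (M.hold_meas n).aemeasurable]
    have hm : ∀ t ∈ Set.Ioi (0:ℝ), ((M.μ x).restrict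
        (M.cyl ∅ p n 0 ∩ {ω | M.jump (n+1) ω = y})) {ω | t < M.hold n ω} =
        M.wt p n * M.Pe (p n) y * ENNReal.ofReal (Real.exp (-(M.γ (p n)) * t)) := by
      intro t ht
      rw [Measure.restrict_apply (measurableSet_lt measurable_const (M.hold_meas n))]
      have := M.law x (n+1) p' (fun k => if k = n then t else 0)
        (by rw [hp'k 0 (Nat.zero_le _), hp]) (fun k => by
          have := (Set.mem_Ioi.1 ht).le
          split_ifs <;> simp [this])
      have hs : {ω | t < M.hold n ω} ∩ (M.cyl ∅ p n 0 ∩ {ω | M.jump (n+1) ω = y}) =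
        {ω | (∀ k, k ≤ n+1 → M.jump k ω = p' k) ∧
          (∀ k, k < n+1 → (if k = n then t else 0) < M.hold k ω)} := by
        ext ω
        simp only [cyl, Set.mem_inter_iff, Set.mem_ofPred_eq, Set.mem_empty_iff_false,
          not_false_iff, implies_true, and_true]
        constructor
        · rintro ⟨h0, h1, h3⟩
          refine ⟨fun k hk => ?_, fun k hk => ?_⟩
          · rcases Nat.lt_or_ge n k with hkn | hkn
            · obtain rfl : k = n+1 := by omega
              rw [hp'n, h3]
            · rw [hp'k k hkn, h1 k hkn]
          · split_ifs with hkn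
            · rw [hkn]; exact h0
            · exact M.hold_pos k ω
        · rintro ⟨h1, h2⟩
          refine ⟨by simpa using h2 n (by omega), fun k hk => ?_, ?_⟩
          · rw [h1 k (by omega), hp'k k hk]
          · rw [h1 (n+1) le_rfl, hp'n]
      rw [hs, this, ENNReal.ofReal_prod_of_nonneg
        (fun k _ => mul_nonneg (M.tr_nonneg _ _) (Real.exp_pos _).le),
        Finset.prod_range_succ, hp'n, hp'k n le_rfl, if_pos rfl,
        ENNReal.ofReal_mul (M.tr_nonneg _ _)]
      rw [mul_assoc]
      congr 1
      unfold wt Pe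
      refine Finset.prod_congr rfl fun k hk => ?_
      have := Finset.mem_range.1 hk
      rw [hp'k k (by omega), hp'k (k+1) (by omega), if_neg (show ¬ k = n by omega)]
      simp
    rw [setLIntegral_congr_fun measurableSet_Ioi hm, lintegral_const_mul _ (by fun_prop),
      exp_lint _ (M.γ_pos _)]
    ring
  simp only [key]
  rw [ENNReal.tsum_mul_left, Pe_sum, mul_one]

/-- survival event -/
def surv (M : CTMC) (A : Set M.X) (m : ℕ) : Set M.Ω := {ω | ∀ k, k ≤ m → M.jump k ω ∉ A}

lemma meas_surv (M : CTMC) (A : Set M.X) (m : ℕ) : MeasurableSet (M.surv A m) := by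
  unfold surv
  simp only [Set.ofPred_forall]
  exact MeasurableSet.iInter fun k => MeasurableSet.iInter fun _ => M.meas_mem k Aᶜ

lemma surv_lint (M : CTMC) (x : M.X) (A : Set M.X) (r : M.X → ℝ≥0∞) (Z : ℕ → M.Ω → ℝ≥0∞)
    (hZ : ∀ n (p : ℕ → M.X), p 0 = x →
      ∫⁻ ω in M.cyl ∅ p n 0, Z n ω ∂ M.μ x = M.wt p n * r (p n)) (m : ℕ) :
      ∫⁻ ω in M.surv A m, Z m ω ∂ M.μ x = M.q A r m x := by
  have h := M.cyl_lint x A r Z hZ m 0 (fun _ => x) rfl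
  simp only [wt, Finset.range_zero, Finset.prod_empty, one_mul, zero_add] at h
  rw [← h]
  refine setLIntegral_congr ?_
  have h1 : ∀ᵐ ω ∂ M.μ x, M.jump 0 ω = x := by
    exact (prob_compl_eq_zero_iff (M.jump_meas 0 x)).2 (M.start x)
  filter_upwards [h1] with ω hω
  refine propext ?_
  change ω ∈ M.surv A m ↔ ω ∈ M.cyl A (fun _ => x) 0 m
  simp [surv, cyl, hω]

end CTMC

namespace CTMC

/-- survival probabilities -/
noncomputable abbrev w (M : CTMC) (A : Set M.X) : ℕ → M.X → ℝ≥0∞ := M.q A (fun _ => 1)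

lemma q_mem (M : CTMC) (A : Set M.X) (r : M.X → ℝ≥0∞) (m : ℕ) {x : M.X} (hx : x ∈ A) :
    M.q A r m x = 0 := by
  cases m <;> simp [q, hx]

lemma q_succ (M : CTMC) (A : Set M.X) (r : M.X → ℝ≥0∞) (m : ℕ) {x : M.X} (hx : x ∉ A) :
    M.q A r (m+1) x = M.PP (M.q A r m) x := by
  simp [q, hx]

lemma q_zero (M : CTMC) (A : Set M.X) (r : M.X → ℝ≥0∞) {x : M.X} (hx : x ∉ A) :
    M.q A r 0 x = r x := by
  simp [q, hx]

lemma w_le_one (M : CTMC) (A : Set M.X) (m : ℕ) : ∀ x, M.w A m x ≤ 1 := by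
  induction m with
  | zero =>
    intro x
    by_cases hx : x ∈ A
    · simp [w, q_mem, hx]
    · simp [w, q_zero, hx]
  | succ m ih =>
    intro x
    by_cases hx : x ∈ A
    · simp [w, q_mem, hx]
    · rw [w, q_succ _ _ _ _ hx]
      exact (M.PP_mono ih x).trans (M.PP_one x).le

lemma w_succ_le (M : CTMC) (A : Set M.X) (m : ℕ) : ∀ x, M.w A (m+1) x ≤ M.w A m x := by
  induction m with
  | zero =>
    intro x
    by_cases hx : x ∈ A
    · simp [w, q_mem, hx]
    · rw [w, q_zero _ _ _ hx]
      exact M.w_le_one A 1 x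
  | succ m ih =>
    intro x
    by_cases hx : x ∈ A
    · simp [w, q_mem, hx]
    · rw [w, q_succ _ _ _ _ hx, q_succ _ _ _ _ hx]
      exact M.PP_mono ih x

lemma w_anti (M : CTMC) (A : Set M.X) (x : M.X) : Antitone (fun m => M.w A m x) :=
  antitone_nat_of_succ_le fun m => M.w_succ_le A m x

lemma w_lt_one_path (M : CTMC) (A : Set M.X) (n : ℕ) : ∀ p : ℕ → M.X, p n ∈ A →
    (∀ k, k < n → 0 < (if p (k+1) = p k then 0 else M.Γ (p k) (p (k+1)) / M.γ (p k))) →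
    M.w A n (p 0) < 1 := by
  induction n with
  | zero =>
    intro p hp _
    simp [w, q_mem, hp]
  | succ n ih =>
    intro p hp hk
    by_cases hx : p 0 ∈ A
    · simp [w, q_mem, hx]
    · have h1 := ih (fun k => p (k+1)) hp (fun k hkn => hk (k+1) (by omega))
      rw [w, q_succ _ _ _ _ hx]
      refine lt_of_lt_of_le ?_ (M.PP_one (p 0)).le
      have hne : M.Pe (p 0) (p 1) ≠ 0 := (ENNReal.ofReal_pos.2 (hk 0 (by omega))).ne'
      refine ENNReal.tsum_lt_tsum (i := p 1) ?_ ?_ ?_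
      · refine ne_top_of_le_ne_top ENNReal.one_ne_top ((M.PP_mono (M.w_le_one A n) (p 0)).trans ?_)
        rw [M.PP_one]
      · intro y
        exact mul_le_mul_right (M.w_le_one A n y) _
      · exact (ENNReal.mul_lt_mul_iff_right hne ENNReal.ofReal_ne_top).2 h1

lemma w_lt_one (M : CTMC) (A : Set M.X) (hA : A.Nonempty) (x : M.X) : ∃ n, M.w A n x < 1 := by
  obtain ⟨a, ha⟩ := hA
  obtain ⟨n, p, h0, hn, hk⟩ := M.irr x a
  exact ⟨n, h0 ▸ M.w_lt_one_path A n p (hn ▸ ha) hk⟩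

lemma tendsto_of_mul {c : ℝ≥0∞} (hc : c ≠ 0) (hc' : c ≠ ⊤) {u v : ℕ → ℝ≥0∞}
    (hv : Tendsto v atTop (nhds 0)) (h : ∀ n, c * u n ≤ v n) : Tendsto u atTop (nhds 0) := by
  have h2 : Tendsto (fun n => c⁻¹ * v n) atTop (nhds (c⁻¹ * 0)) :=
    ENNReal.Tendsto.const_mul hv (Or.inr (ENNReal.inv_ne_top.2 hc))
  rw [mul_zero] at h2
  refine tendsto_of_tendsto_of_tendsto_of_le_of_le tendsto_const_nhds h2 (fun _ => zero_le) ?_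
  intro n
  calc u n = c⁻¹ * (c * u n) := by
        rw [← mul_assoc, ENNReal.inv_mul_cancel hc hc', one_mul]
    _ ≤ _ := mul_le_mul_right (h n) _

lemma rec_step (M : CTMC) (hrec : M.JumpRecurrent) (a y : M.X) (hy : M.Pe a y ≠ 0) :
    Tendsto (fun n => M.w {a} n y) atTop (nhds 0) := by
  let p : ℕ → M.X := fun k => if k = 0 then a else y
  have hcyl : ∀ m, M.μ a (M.cyl {a} p 1 m) = M.Pe a y * M.w {a} m y := by
    intro m
    have := M.cyl_lint a {a} (fun _ => 1) (fun _ _ => 1) (fun n p hp => M.base_one a n p hp) m 1 p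
      (by simp [p])
    simpa [wt, p] using this
  have hT : Tendsto (fun m => M.μ a (M.cyl {a} p 1 m)) atTop
      (nhds (M.μ a (⋂ m, M.cyl {a} p 1 m))) := by
    refine tendsto_measure_iInter_atTop (fun m => (M.meas_cyl _ _ _ _).nullMeasurableSet) ?_
      ⟨0, measure_ne_top _ _⟩
    intro m m' hmm ω hω
    exact ⟨hω.1, fun k hk hk' => hω.2 k hk (by omega)⟩
  have h0 : M.μ a (⋂ m, M.cyl {a} p 1 m) = 0 := by
    have hr := hrec a
    have hmeas : MeasurableSet {ω | ∃ n, 1 ≤ n ∧ M.jump n ω = a} := by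
      have : {ω | ∃ n, 1 ≤ n ∧ M.jump n ω = a} = ⋃ n, ⋃ _ : 1 ≤ n, {ω | M.jump n ω = a} := by
        ext ω; simp
      rw [this]
      exact MeasurableSet.iUnion fun n => MeasurableSet.iUnion fun _ => M.jump_meas n a
    rw [← prob_compl_eq_zero_iff hmeas] at hr
    refine measure_mono_null ?_ hr
    intro ω hω
    rw [Set.mem_iInter] at hω
    rintro ⟨n, hn, hna⟩
    exact (hω n).2 n hn (by omega) hna
  rw [h0] at hT
  exact tendsto_of_mul hy ENNReal.ofReal_ne_top hT fun n => (hcyl n).ge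

lemma w_tendsto (M : CTMC) (hrec : M.JumpRecurrent) (a x : M.X) :
    Tendsto (fun n => M.w {a} n x) atTop (nhds 0) := by
  obtain ⟨n, p, h0, hn, hk⟩ := M.irr a x
  have key : ∀ k, k ≤ n → Tendsto (fun m => M.w {a} m (p k)) atTop (nhds 0) := by
    intro k
    induction k with
    | zero =>
      intro _
      rw [h0]
      simp [w, q_mem]
    | succ k ih =>
      intro hkn
      have hne : M.Pe (p k) (p (k+1)) ≠ 0 := (ENNReal.ofReal_pos.2 (hk k (by omega))).ne'
      by_cases hpk : p k = a
      · exact M.rec_step hrec a _ (hpk ▸ hne)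
      · have h1 := (tendsto_add_atTop_iff_nat 1).2 (ih (by omega))
        refine tendsto_of_mul hne ENNReal.ofReal_ne_top h1 fun m => ?_
        rw [w, q_succ _ _ _ _ (show p k ∉ ({a} : Set M.X) from hpk)]
        exact ENNReal.le_tsum (f := fun y => M.Pe (p k) y * M.q {a} (fun _ => 1) m y) (p (k+1))
  exact hn ▸ key n le_rfl

lemma hit_ae (M : CTMC) (hrec : M.JumpRecurrent) (A : Set M.X) (hA : A.Nonempty) (x : M.X) :
    ∀ᵐ ω ∂ M.μ x, ∃ n, M.jump n ω ∈ A := by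
  obtain ⟨a, ha⟩ := hA
  have hw : ∀ n, M.μ x {ω | ¬ ∃ n, M.jump n ω ∈ A} ≤ M.w {a} n x := by
    intro n
    have := M.surv_lint x {a} (fun _ => 1) (fun _ _ => 1) (fun n p hp => M.base_one x n p hp) n
    rw [w, ← this]
    simp only [lintegral_const, one_mul, Measure.restrict_apply MeasurableSet.univ, Set.univ_inter]
    refine measure_mono ?_
    intro ω hω k _ hk
    exact hω ⟨k, by rw [Set.mem_singleton_iff.1 hk]; exact ha⟩
  have := ge_of_tendsto' (M.w_tendsto hrec a x) hw
  exact le_antisymm this zero_le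

/-! ### the passage time -/

lemma J_mono (M : CTMC) (ω : M.Ω) : Monotone (fun n => M.J n ω) := by
  refine monotone_nat_of_le_succ fun n => ?_
  simp only [J, Finset.sum_range_succ]
  linarith [M.hold_pos n ω]

lemma tau_lower (M : CTMC) (A : Set M.X) (ω : M.Ω) :
    ∑' k, (M.surv A k).indicator (fun ω => ENNReal.ofReal (M.hold k ω)) ω ≤ M.tau A ω := by
  refine le_sInf ?_
  rintro _ ⟨s, ⟨hs0, a, ha, hpos⟩, rfl⟩
  unfold pos at hpos
  split_ifs at hpos with h
  have hn := h.choose_spec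
  set n := h.choose
  have hja : M.jump n ω = a := by simpa using hpos
  rw [tsum_eq_sum (s := Finset.range n)]
  · calc _ ≤ ∑ k ∈ Finset.range n, ENNReal.ofReal (M.hold k ω) :=
          Finset.sum_le_sum fun k _ => Set.indicator_le_self (M.surv A k) (fun ω => ENNReal.ofReal (M.hold k ω)) ω
      _ = ENNReal.ofReal (M.J n ω) := by
          rw [J, ENNReal.ofReal_sum_of_nonneg fun k _ => (M.hold_pos k ω).le]
      _ ≤ _ := ENNReal.ofReal_le_ofReal hn.1
  · intro k hk
    refine Set.indicator_of_notMem ?_ _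
    intro hsv
    exact hsv n (by simpa using hk) (by rw [hja]; exact ha)

lemma tau_upper (M : CTMC) (A : Set M.X) (ω : M.Ω) (hω : ∃ n, M.jump n ω ∈ A) :
    M.tau A ω ≤ ∑' k, (M.surv A k).indicator (fun ω => ENNReal.ofReal (M.hold k ω)) ω := by
  set n := Nat.find hω with hndef
  have hn : M.jump n ω ∈ A := Nat.find_spec hω
  have hlt : ∀ k, k < n → M.jump k ω ∉ A := fun k hk => Nat.find_min hω hk
  have hJ : M.tau A ω ≤ ENNReal.ofReal (M.J n ω) := by
    refine sInf_le ⟨M.J n ω, ⟨?_, M.jump n ω, hn, ?_⟩, rfl⟩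
    · exact Finset.sum_nonneg fun k _ => (M.hold_pos k ω).le
    · have hex : ∃ k, M.J k ω ≤ M.J n ω ∧ M.J n ω < M.J (k+1) ω := by
        refine ⟨n, le_rfl, ?_⟩
        simp only [J, Finset.sum_range_succ]
        linarith [M.hold_pos n ω]
      have hlt2 : ∀ k, M.J k ω < M.J (k+1) ω := fun k => by
        simp only [J, Finset.sum_range_succ]
        linarith [M.hold_pos k ω]
      have huniq : hex.choose = n := by
        obtain ⟨h1, h2⟩ := hex.choose_spec
        set k := hex.choose
        rcases lt_trichotomy k n with hc | hc | hc
        · have : M.J (k+1) ω ≤ M.J n ω := M.J_mono ω hc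
          linarith
        · exact hc
        · have : M.J (n+1) ω ≤ M.J k ω := M.J_mono ω hc
          linarith [hlt2 n]
      unfold pos
      rw [dif_pos hex, huniq]
  refine hJ.trans ?_
  rw [J, ENNReal.ofReal_sum_of_nonneg fun k _ => (M.hold_pos k ω).le]
  refine le_trans (Finset.sum_le_sum fun k hk => ?_) (ENNReal.sum_le_tsum (Finset.range n))
  rw [Set.indicator_of_mem]
  intro j hj
  exact hlt j (by have := Finset.mem_range.1 hk; omega)

/-- mean holding time -/
noncomputable abbrev rr (M : CTMC) : M.X → ℝ≥0∞ := fun x => ENNReal.ofReal (1 / M.γ x)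

lemma lint_tsum (M : CTMC) (A : Set M.X) (x : M.X) :
    ∫⁻ ω, ∑' k, (M.surv A k).indicator (fun ω => ENNReal.ofReal (M.hold k ω)) ω ∂ M.μ x
      = ∑' k, M.q A M.rr k x := by
  rw [lintegral_tsum]
  · congr 1; ext k
    rw [lintegral_indicator (M.meas_surv A k)]
    exact M.surv_lint x A M.rr (fun k ω => ENNReal.ofReal (M.hold k ω))
      (fun n p hp => M.base_hold x n p hp) k
  · intro k
    exact ((M.hold_meas k).ennreal_ofReal.indicator (M.meas_surv A k)).aemeasurable

lemma tau_ge (M : CTMC) (A : Set M.X) (x : M.X) :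
    ∑' k, M.q A M.rr k x ≤ ∫⁻ ω, M.tau A ω ∂ M.μ x := by
  rw [← M.lint_tsum A x]
  exact lintegral_mono fun ω => M.tau_lower A ω

lemma tau_le (M : CTMC) (hrec : M.JumpRecurrent) (A : Set M.X) (hA : A.Nonempty) (x : M.X) :
    ∫⁻ ω, M.tau A ω ∂ M.μ x ≤ ∑' k, M.q A M.rr k x := by
  rw [← M.lint_tsum A x]
  refine lintegral_mono_ae ?_
  filter_upwards [M.hit_ae hrec A hA x] with ω hω
  exact M.tau_upper A ω hω

lemma H_eq (M : CTMC) (A : Set M.X) (r : M.X → ℝ≥0∞) {x : M.X} (hx : x ∉ A) :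
    ∑' k, M.q A r k x = r x + M.PP (fun y => ∑' k, M.q A r k y) x := by
  rw [PP_tsum, tsum_eq_zero_add' ENNReal.summable, q_zero _ _ _ hx]
  simp only [q_succ _ _ _ _ hx]

lemma H_le (M : CTMC) (A : Set M.X) (r u : M.X → ℝ≥0∞)
    (hu : ∀ x, x ∉ A → r x + M.PP u x ≤ u x) (x : M.X) : ∑' k, M.q A r k x ≤ u x := by
  have key : ∀ n x, ∑ k ∈ Finset.range n, M.q A r k x ≤ u x := by
    intro n
    induction n with
    | zero => intro x; simp
    | succ n ih =>
      intro x
      by_cases hx : x ∈ A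
      · simp [q_mem, hx]
      · rw [Finset.sum_range_succ', q_zero _ _ _ hx]
        simp only [q_succ _ _ _ _ hx]
        rw [← PP_sum, add_comm]
        exact le_trans (add_le_add le_rfl (M.PP_mono ih x)) (hu x hx)
  rw [ENNReal.tsum_eq_iSup_nat]
  exact iSup_le fun n => key n x

/-- bridge between real and extended-real generators -/
lemma bridge (M : CTMC) (f : M.X → ℝ) (B : ℝ) (hf0 : ∀ x, 0 ≤ f x) (hfB : ∀ x, f x ≤ B) :
    M.InDom f ∧ ∀ x, 0 ≤ M.gen f x / M.γ x + f x ∧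
      M.PP (fun y => ENNReal.ofReal (f y)) x = ENNReal.ofReal (M.gen f x / M.γ x + f x) := by
  have hdom : M.InDom f := by
    intro x
    refine Summable.of_nonneg_of_le ?_ ?_ ((M.γ_sum x).summable.mul_right B)
    · intro y
      split_ifs with h
      · exact le_rfl
      · exact mul_nonneg (M.Γ_offdiag_nonneg x y h) (hf0 y)
    · intro y
      split_ifs with h
      · simp
      · exact mul_le_mul_of_nonneg_left (hfB y) (M.Γ_offdiag_nonneg x y h)
  refine ⟨hdom, fun x => ?_⟩
  have hγ := M.γ_pos x
  have he : (fun y => (if y = x then 0 else M.Γ x y * f y) / M.γ x) =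
      fun y => (if y = x then 0 else M.Γ x y / M.γ x) * f y := by
    ext y
    split_ifs
    · simp
    · ring
  have hs : Summable (fun y => (if y = x then 0 else M.Γ x y / M.γ x) * f y) := by
    rw [← he]; exact (hdom x).div_const _
  have hsum : M.gen f x / M.γ x + f x = ∑' y, (if y = x then 0 else M.Γ x y / M.γ x) * f y := by
    rw [← he, tsum_div_const, gen]
    field_simp
    ring
  have hnn : ∀ y, 0 ≤ (if y = x then 0 else M.Γ x y / M.γ x) * f y := fun y =>
    mul_nonneg (M.tr_nonneg x y) (hf0 y)
  rw [hsum]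
  refine ⟨tsum_nonneg hnn, ?_⟩
  rw [ENNReal.ofReal_tsum_of_nonneg hnn hs]
  unfold PP Pe
  congr 1; ext y
  rw [ENNReal.ofReal_mul (M.tr_nonneg x y)]

end CTMC

namespace CTMC

lemma dir1 (M : CTMC) (hrec : M.JumpRecurrent) (f : M.X → ℝ) (a ε : ℝ) (hf : M.InDomPos f)
    (hbdd : BddAbove (Set.range f)) (hfin : {x : M.X | f x ≤ a}.Finite) (hε : 0 < ε)
    (hgen : ∀ x : M.X, a < f x → M.gen f x ≤ -ε) (A : Set M.X) (hA : A.Nonempty) :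
    ∃ C : ℝ, 0 < C ∧ ∀ x, x ∉ A → ∫⁻ ω, M.tau A ω ∂ M.μ x ≤ ENNReal.ofReal C := by
  obtain ⟨B, hB⟩ := hbdd
  have hfB : ∀ x, f x ≤ B := fun x => hB ⟨x, rfl⟩
  obtain ⟨-, hbr⟩ := M.bridge f B hf.1 hfB
  choose n hn using M.w_lt_one A hA
  obtain ⟨N, hN⟩ : ∃ N, ∀ x, f x ≤ a → M.w A N x < 1 := by
    refine ⟨hfin.toFinset.sup n, fun x hx => ?_⟩
    have : n x ≤ hfin.toFinset.sup n := Finset.le_sup (by simpa using hx)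
    exact lt_of_le_of_lt (M.w_anti A x this) (hn x)
  set e : ℝ≥0∞ := ENNReal.ofReal (1 / ε) with he
  set Pf : M.X → ℝ≥0∞ := M.PP (fun y => ENNReal.ofReal (f y)) with hPf
  have hPft : ∀ x, Pf x ≠ ⊤ := fun x => by rw [(hbr x).2]; exact ENNReal.ofReal_ne_top
  set L : M.X → ℝ≥0∞ := fun x => M.rr x + e * Pf x with hL
  have hLt : ∀ x, L x ≠ ⊤ := fun x =>
    ENNReal.add_ne_top.2 ⟨ENNReal.ofReal_ne_top, ENNReal.mul_ne_top ENNReal.ofReal_ne_top (hPft x)⟩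
  set K : ℝ≥0∞ := ∑ x ∈ hfin.toFinset, L x / (1 - M.w A N x) with hK
  have hd : ∀ x, f x ≤ a → 1 - M.w A N x ≠ 0 := fun x hx => (tsub_pos_of_lt (hN x hx)).ne'
  have hKt : K ≠ ⊤ := by
    refine ENNReal.sum_ne_top.2 fun x hx => ?_
    exact ENNReal.div_ne_top (hLt x) (hd x (by simpa using hx))
  have hKL : ∀ x, f x ≤ a → L x ≤ K * (1 - M.w A N x) := by
    intro x hx
    have h1 : L x / (1 - M.w A N x) ≤ K :=
      Finset.single_le_sum (f := fun x => L x / (1 - M.w A N x)) (fun _ _ => zero_le)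
        (by simpa using hx)
    calc L x = L x / (1 - M.w A N x) * (1 - M.w A N x) :=
          (ENNReal.div_mul_cancel (hd x hx)
            (ne_top_of_le_ne_top ENNReal.one_ne_top tsub_le_self)).symm
      _ ≤ _ := mul_le_mul_left h1 _
  set v : M.X → ℝ≥0∞ := fun x => ∑ m ∈ Finset.range N, M.w A m x with hv
  have hvN : ∀ x, v x ≤ N := by
    intro x
    calc v x ≤ ∑ m ∈ Finset.range N, 1 := Finset.sum_le_sum fun m _ => M.w_le_one A m x
      _ = N := by simp
  have hPv : ∀ x, x ∉ A → M.PP v x + (1 - M.w A N x) = v x := by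
    intro x hx
    have h1 : M.PP v x = ∑ m ∈ Finset.range N, M.w A (m+1) x := by
      rw [hv, PP_sum]
      refine Finset.sum_congr rfl fun m _ => ?_
      rw [w, q_succ _ _ _ _ hx]
    have h2 : M.PP v x + 1 = v x + M.w A N x := by
      have := Finset.sum_range_succ' (fun m => M.w A m x) N
      rw [Finset.sum_range_succ, w, q_zero _ _ _ hx] at this
      rw [h1]; exact this.symm
    have hw1 := M.w_le_one A N x
    have hwt : M.w A N x ≠ ⊤ := ne_top_of_le_ne_top ENNReal.one_ne_top hw1
    refine (ENNReal.add_left_inj hwt).1 ?_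
    rw [add_assoc, tsub_add_cancel_of_le hw1, h2]
  set u : M.X → ℝ≥0∞ := fun x => e * ENNReal.ofReal (f x) + K * v x with hu
  have hPu : ∀ x, M.PP u x = e * Pf x + K * M.PP v x := by
    intro x
    rw [hu, PP_add, PP_smul, PP_smul]
  have hsuper : ∀ x, x ∉ A → M.rr x + M.PP u x ≤ u x := by
    intro x hx
    rw [hPu, ← add_assoc]
    by_cases hxa : f x ≤ a
    · calc M.rr x + e * Pf x + K * M.PP v x ≤ K * (1 - M.w A N x) + K * M.PP v x :=
            add_le_add (hKL x hxa) le_rfl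
        _ = K * v x := by rw [← mul_add, add_comm, hPv x hx]
        _ ≤ u x := le_add_self
    · refine add_le_add ?_ (mul_le_mul_right ?_ _)
      · rw [(hbr x).2, he, ← ENNReal.ofReal_mul (by positivity),
          ← ENNReal.ofReal_mul (by positivity), ← ENNReal.ofReal_add
            (by have := M.γ_pos x; positivity)
            (mul_nonneg (by positivity) (hbr x).1)]
        refine ENNReal.ofReal_le_ofReal ?_
        have hg := hgen x (not_le.1 hxa)
        have hγ := M.γ_pos x
        have h3 : M.gen f x / M.γ x ≤ -ε / M.γ x := div_le_div_of_nonneg_right hg hγ.le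
        have h4 : 1 / ε * (M.gen f x / M.γ x + f x) ≤ 1 / ε * (-ε / M.γ x + f x) :=
          mul_le_mul_of_nonneg_left (by linarith) (by positivity)
        have h5 : 1 / ε * (-ε / M.γ x + f x) = 1 / ε * f x - 1 / M.γ x := by
          field_simp
          ring
        linarith
      · rw [← hPv x hx]; exact le_self_add
  set D : ℝ≥0∞ := e * ENNReal.ofReal B + K * N with hD
  have hDt : D ≠ ⊤ := ENNReal.add_ne_top.2
    ⟨ENNReal.mul_ne_top ENNReal.ofReal_ne_top ENNReal.ofReal_ne_top,
      ENNReal.mul_ne_top hKt (ENNReal.natCast_ne_top N)⟩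
  refine ⟨D.toReal + 1, by positivity, fun x _ => ?_⟩
  calc ∫⁻ ω, M.tau A ω ∂ M.μ x ≤ ∑' k, M.q A M.rr k x := M.tau_le hrec A hA x
    _ ≤ u x := M.H_le A M.rr u hsuper x
    _ ≤ D := add_le_add (mul_le_mul_right (ENNReal.ofReal_le_ofReal (hfB x)) _)
        (mul_le_mul_right (hvN x) _)
    _ = ENNReal.ofReal D.toReal := (ENNReal.ofReal_toReal hDt).symm
    _ ≤ _ := ENNReal.ofReal_le_ofReal (by linarith)

lemma dir2 (M : CTMC) (h : ∀ A : Set M.X, A.Finite → A.Nonempty → ∃ C : ℝ, 0 < C ∧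
      ∀ x, x ∉ A → ∫⁻ ω, M.tau A ω ∂ M.μ x ≤ ENNReal.ofReal C) :
    ∃ (f : M.X → ℝ) (a ε : ℝ), M.InDomPos f ∧ BddAbove (Set.range f) ∧
      0 < a ∧ a < (⨆ x, f x) ∧ {x : M.X | f x ≤ a}.Finite ∧ 0 < ε ∧
      ∀ x : M.X, a < f x → M.gen f x ≤ -ε := by
  obtain ⟨x0⟩ : Nonempty M.X := inferInstance
  obtain ⟨x1, hx1⟩ := exists_ne x0
  set A : Set M.X := {x0} with hA
  have hx0 : x0 ∈ A := rfl
  have hx1A : x1 ∉ A := hx1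
  obtain ⟨C, hC, hτ⟩ := h A (Set.finite_singleton x0) ⟨x0, rfl⟩
  set H : M.X → ℝ≥0∞ := fun x => ∑' k, M.q A M.rr k x with hH
  have hHA : ∀ x, x ∈ A → H x = 0 := fun x hx => by simp [hH, q_mem, hx]
  have hHC : ∀ x, H x ≤ ENNReal.ofReal C := by
    intro x
    by_cases hx : x ∈ A
    · rw [hHA x hx]; exact zero_le
    · exact (M.tau_ge A x).trans (hτ x hx)
  set i : M.X → ℝ≥0∞ := fun x => if x ∈ A then 0 else 1 with hi
  have hi1 : ∀ x, i x ≤ 1 := fun x => by rw [hi]; dsimp only; split_ifs <;> simp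
  set u : M.X → ℝ≥0∞ := fun x => H x + i x with hu
  have huC : ∀ x, u x ≤ ENNReal.ofReal (C + 1) := by
    intro x
    rw [ENNReal.ofReal_add hC.le zero_le_one, ENNReal.ofReal_one]
    exact add_le_add (hHC x) (hi1 x)
  have hut : ∀ x, u x ≠ ⊤ := fun x => ne_top_of_le_ne_top ENNReal.ofReal_ne_top (huC x)
  have hsuper : ∀ x, x ∉ A → M.rr x + M.PP u x ≤ u x := by
    intro x hx
    rw [hu, PP_add, ← add_assoc]
    refine add_le_add (M.H_eq A M.rr hx).ge ?_
    refine ((M.PP_mono hi1 x).trans (M.PP_one x).le).trans ?_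
    simp [hi, hx]
  set f : M.X → ℝ := fun x => (u x).toReal with hf
  have hf0 : ∀ x, 0 ≤ f x := fun x => ENNReal.toReal_nonneg
  have hfC : ∀ x, f x ≤ C + 1 := fun x => ENNReal.toReal_le_of_le_ofReal (by linarith) (huC x)
  have hfu : (fun y => ENNReal.ofReal (f y)) = u := by
    ext y; exact ENNReal.ofReal_toReal (hut y)
  have hfA : ∀ x, x ∉ A → 1 ≤ f x := by
    intro x hx
    have : (1 : ℝ≥0∞) ≤ u x := by
      simp only [hu, hi, hx, if_false]; exact le_add_self
    have := ENNReal.toReal_mono (hut x) this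
    simpa using this
  have hfA' : ∀ x, x ∈ A → f x = 0 := by
    intro x hx
    simp [hf, hu, hi, hx, hHA x hx]
  obtain ⟨hdom, hbr⟩ := M.bridge f (C+1) hf0 hfC
  have hbdd : BddAbove (Set.range f) := ⟨C + 1, by rintro _ ⟨x, rfl⟩; exact hfC x⟩
  refine ⟨f, 1/2, 1, ⟨hf0, hdom⟩, hbdd, by norm_num, ?_, ?_, one_pos, ?_⟩
  · have := le_ciSup hbdd x1
    linarith [hfA x1 hx1A]
  · refine (Set.finite_singleton x0).subset ?_
    intro x hx
    by_contra hxA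
    have h1 : f x ≤ 1/2 := hx
    linarith [hfA x hxA]
  · intro x hx
    have hxA : x ∉ A := fun hxA => by rw [hfA' x hxA] at hx; norm_num at hx
    have h1 := hsuper x hxA
    have hγ := M.γ_pos x
    rw [← hfu, (hbr x).2, ← ENNReal.ofReal_add (by positivity) (hbr x).1] at h1
    have h2 := (ENNReal.ofReal_le_ofReal_iff (hf0 x)).1 h1
    have h3 : 1 / M.γ x + M.gen f x / M.γ x ≤ 0 := by linarith
    rw [← add_div, div_nonpos_iff] at h3
    rcases h3 with h3 | h3 <;> linarith [h3.1, h3.2]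

end CTMC

open CTMC in
/-- Theorem (implosion, part 1): assuming the embedded chain is recurrent,
the existence of a bounded Lyapunov function `f` with a finite sublevel set
`{f ≤ a}` (for some `0 < a < sup f`) and `Γ f ≤ -ε` outside it is equivalent
to implosion towards every finite nonempty set `A` (uniformly bounded
`E_x τ_A` for `x ∉ A`). -/
theorem statement7 (M : CTMC) (hrec : M.JumpRecurrent) :
    (∃ (f : M.X → ℝ) (a ε : ℝ), M.InDomPos f ∧ BddAbove (Set.range f) ∧
      0 < a ∧ a < (⨆ x, f x) ∧ {x : M.X | f x ≤ a}.Finite ∧ 0 < ε ∧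
      ∀ x : M.X, a < f x → M.gen f x ≤ -ε) ↔
    (∀ A : Set M.X, A.Finite → A.Nonempty → ∃ C : ℝ, 0 < C ∧
      ∀ x, x ∉ A → ∫⁻ ω, M.tau A ω ∂ M.μ x ≤ ENNReal.ofReal C) := by
  constructor
  · rintro ⟨f, a, ε, hf, hbdd, ha, hab, hfin, hε, hgen⟩ A hAf hAn
    exact M.dir1 hrec f a ε hf hbdd hfin hε hgen A hAn
  · intro h
    exact M.dir2 h
end
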